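/- arXiv:1501.04320 — 3 statements merged into one kernel-verified Lean document; each statement's English description precedes it below -/
import Mathlib

section
/- Continuity of the potential of local minimizers for power-law repulsion: Let N ≥ 1, 0 < s ≤ 1 with 2s < N, and a > 0, and let W(x) = |x|^a/a − |x|^{2s−N}/(2s−N) (so the repulsive part equals |x|^{2s−N}/(N−2s) ≥ 0 and W ≥ 0). If μ ∈ 𝒫₂(ℝ^N) is a d₂-local minimizer of the interaction energy E, then the potential ψ = W∗μ is a continuous function from ℝ^N to [0,∞]. -/
open MeasureTheory Real Set Filter ENNReal

noncomputable section

/-- `ℝ^N` as a Euclidean space. -/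
abbrev Euc (N : ℕ) := EuclideanSpace ℝ (Fin N)

/-- `μ ∈ 𝒫₂(ℝ^N)`: a Borel probability measure with finite second moment. -/
def IsProb2 (N : ℕ) (μ : Measure (Euc N)) : Prop :=
  IsProbabilityMeasure μ ∧ (∫⁻ x : Euc N, ENNReal.ofReal (‖x‖ ^ 2) ∂μ) < ⊤

/-- The 2-Wasserstein distance `d₂(μ,ν)` (valued in `[0,∞]`), defined as the infimum
over transference plans `π` with marginals `μ` and `ν` of `(∬ |x−y|² dπ)^{1/2}`. -/
noncomputable def wass2 (N : ℕ) (μ ν : Measure (Euc N)) : ℝ≥0∞ :=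
  ⨅ pl ∈ {pl : Measure (Euc N × Euc N) |
      IsProbabilityMeasure pl ∧ pl.map Prod.fst = μ ∧ pl.map Prod.snd = ν},
    (∫⁻ p : Euc N × Euc N, ENNReal.ofReal (‖p.1 - p.2‖ ^ 2) ∂pl) ^ (1/2 : ℝ)

/-- The interaction energy `E[μ] = (1/2) ∬ W(x−y) dμ(x) dμ(y)` for a nonnegative
(possibly infinite-valued) interaction potential `W`. -/
noncomputable def interE (N : ℕ) (W : Euc N → ℝ≥0∞) (μ : Measure (Euc N)) : ℝ≥0∞ :=
  (1/2 : ℝ≥0∞) * ∫⁻ x : Euc N, ∫⁻ y : Euc N, W (x - y) ∂μ ∂μ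

/-- The potential `ψ = W ∗ μ` associated to `μ`. -/
noncomputable def potential (N : ℕ) (W : Euc N → ℝ≥0∞) (μ : Measure (Euc N)) (x : Euc N) :
    ℝ≥0∞ :=
  ∫⁻ y : Euc N, W (x - y) ∂μ

/-- The support of a measure: points all of whose balls have positive measure. -/
def msupport (N : ℕ) (μ : Measure (Euc N)) : Set (Euc N) :=
  {x : Euc N | ∀ ε : ℝ, 0 < ε → 0 < μ (Metric.ball x ε)}

/-- `μ` is a `d₂`-local minimizer of the interaction energy at scale `ε`. -/
def IsLocalMinAt (N : ℕ) (W : Euc N → ℝ≥0∞) (μ : Measure (Euc N)) (ε : ℝ) : Prop :=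
  IsProb2 N μ ∧ interE N W μ < ⊤ ∧
    ∀ ν : Measure (Euc N), IsProb2 N ν → wass2 N ν μ ≤ ENNReal.ofReal ε →
      interE N W μ ≤ interE N W ν

/-- `μ` is a `d₂`-local minimizer of the interaction energy. -/
def IsLocalMin2 (N : ℕ) (W : Euc N → ℝ≥0∞) (μ : Measure (Euc N)) : Prop :=
  ∃ ε : ℝ, 0 < ε ∧ IsLocalMinAt N W μ ε

end


/-- The power-law repulsive/attractive potential
`W(x) = |x|^a/a + |x|^{2s−N}/(N−2s)`, valued in `[0,∞]` (equal to `∞` at `x = 0`).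
Note that `(ENNReal.ofReal ‖x‖) ^ (2s−N) = ∞` when `x = 0` since `2s − N < 0`. -/
noncomputable def powerLawW (N : ℕ) (s a : ℝ) (x : Euc N) : ℝ≥0∞ :=
  ENNReal.ofReal (‖x‖ ^ a / a) +
    (ENNReal.ofReal ‖x‖) ^ (2 * s - (N : ℝ)) / ENNReal.ofReal ((N : ℝ) - 2 * s)

open scoped Topology

lemma pot_measurable {N : ℕ} {W : Euc N → ℝ≥0∞} (hW : Measurable W) (μ : Measure (Euc N))
    [SFinite μ] : Measurable (potential N W μ) := by
  unfold potential
  exact Measurable.lintegral_prod_right' (f := fun p : Euc N × Euc N => W (p.1 - p.2))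
    (hW.comp (measurable_fst.sub measurable_snd))

lemma pot_comb {N : ℕ} {W : Euc N → ℝ≥0∞} (μ ν : Measure (Euc N)) (c d : ℝ≥0∞) (x : Euc N) :
    potential N W (c • μ + d • ν) x = c * potential N W μ x + d * potential N W ν x := by
  simp [potential, lintegral_add_measure, lintegral_smul_measure]

lemma pot_swap {N : ℕ} {W : Euc N → ℝ≥0∞} (hW : Measurable W) (hs : ∀ x, W (-x) = W x)
    (μ ν : Measure (Euc N)) [SFinite μ] [SFinite ν] :
    ∫⁻ x, potential N W ν x ∂μ = ∫⁻ x, potential N W μ x ∂ν := by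
  unfold potential
  rw [lintegral_lintegral_swap]
  · refine lintegral_congr fun y => lintegral_congr fun x => ?_
    rw [← hs]; simp
  · exact (hW.comp (measurable_fst.sub measurable_snd)).aemeasurable

lemma energy_comb {N : ℕ} {W : Euc N → ℝ≥0∞} (hW : Measurable W) (hs : ∀ x, W (-x) = W x)
    (μ ν : Measure (Euc N)) [SFinite μ] [SFinite ν] (c d : ℝ≥0∞) :
    ∫⁻ x, potential N W (c • μ + d • ν) x ∂(c • μ + d • ν) =
      c * (c * ∫⁻ x, potential N W μ x ∂μ) + 2 * (c * (d * ∫⁻ x, potential N W μ x ∂ν))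
        + d * (d * ∫⁻ x, potential N W ν x ∂ν) := by
  have h1 := pot_measurable hW μ
  have h2 := pot_measurable hW ν
  simp_rw [pot_comb]
  rw [lintegral_add_measure, lintegral_smul_measure, lintegral_smul_measure,
    lintegral_add_left (h1.const_mul c), lintegral_add_left (h1.const_mul c),
    lintegral_const_mul c h1, lintegral_const_mul c h1, lintegral_const_mul d h2,
    lintegral_const_mul d h2, pot_swap hW hs μ ν]
  simp only [smul_eq_mul]
  ring

lemma wass_comb {N : ℕ} (μ ν : Measure (Euc N)) (hμ : IsProbabilityMeasure μ)
    (hν : IsProbabilityMeasure ν) (c d : ℝ≥0∞) (hcd : c + d = 1) :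
    wass2 N (c • μ + d • ν) μ ≤
      (d * ∫⁻ p : Euc N × Euc N, ENNReal.ofReal (‖p.1 - p.2‖ ^ 2) ∂(ν.prod μ)) ^ (1/2 : ℝ) := by
  have hdm : Measurable (fun x : Euc N => (x, x)) := measurable_id.prodMk measurable_id
  unfold wass2
  refine iInf₂_le_of_le (c • μ.map (fun x => (x, x)) + d • ν.prod μ) ?_ ?_
  · refine ⟨⟨?_⟩, ?_, ?_⟩
    · simp [Measure.map_apply hdm, hcd]
    · rw [Measure.map_add _ _ measurable_fst, Measure.map_smul, Measure.map_smul,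
        Measure.map_map measurable_fst hdm, Measure.map_fst_prod]
      have : (Prod.fst ∘ fun x : Euc N => (x, x)) = id := rfl
      simp [this]
    · rw [Measure.map_add _ _ measurable_snd, Measure.map_smul, Measure.map_smul,
        Measure.map_map measurable_snd hdm, Measure.map_snd_prod]
      have : (Prod.snd ∘ fun x : Euc N => (x, x)) = id := rfl
      simp [this, ← add_smul, hcd]
  · gcongr
    rw [lintegral_add_measure, lintegral_smul_measure, lintegral_smul_measure,
      lintegral_map (by fun_prop) hdm]
    simp

lemma cost_fin {N : ℕ} (μ ν : Measure (Euc N)) (hμ : IsProb2 N μ)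
    (hν : IsProb2 N ν) :
    ∫⁻ p : Euc N × Euc N, ENNReal.ofReal (‖p.1 - p.2‖ ^ 2) ∂(ν.prod μ) < ⊤ := by
  have := hμ.1
  have := hν.1
  calc ∫⁻ p : Euc N × Euc N, ENNReal.ofReal (‖p.1 - p.2‖ ^ 2) ∂(ν.prod μ)
      ≤ ∫⁻ p : Euc N × Euc N, (2 * ENNReal.ofReal (‖p.1‖ ^ 2) + 2 * ENNReal.ofReal (‖p.2‖^2))
        ∂(ν.prod μ) := by
        refine lintegral_mono fun p => ?_
        have h2 : ∀ q : ℝ, (2 : ℝ≥0∞) * ENNReal.ofReal q = ENNReal.ofReal (2 * q) := fun q => by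
          rw [ENNReal.ofReal_mul (by norm_num)]; simp
        rw [h2, h2,
          ← ENNReal.ofReal_add (by positivity) (by positivity)]
        apply ENNReal.ofReal_le_ofReal
        have := norm_sub_le p.1 p.2
        have h0 := norm_nonneg (p.1 - p.2)
        nlinarith [sq_nonneg (‖p.1‖ - ‖p.2‖), norm_nonneg p.1, norm_nonneg p.2]
    _ < ⊤ := by
        rw [lintegral_add_left (by fun_prop), lintegral_const_mul _ (by fun_prop),
          lintegral_const_mul _ (by fun_prop), lintegral_prod _ (by fun_prop),
          lintegral_prod _ (by fun_prop)]
        simp only [lintegral_const, measure_univ, mul_one]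
        exact ENNReal.add_lt_top.2 ⟨ENNReal.mul_lt_top (by simp) hν.2,
          ENNReal.mul_lt_top (by simp) hμ.2⟩

lemma first_variation {N : ℕ} {W : Euc N → ℝ≥0∞} (hW : Measurable W) (hs : ∀ x, W (-x) = W x)
    {μ : Measure (Euc N)} (hmin : IsLocalMin2 N W μ) (ν : Measure (Euc N)) (hν : IsProb2 N ν)
    (hE : ∫⁻ x, potential N W ν x ∂ν ≠ ⊤) :
    ∫⁻ x, potential N W μ x ∂μ ≤ ∫⁻ x, potential N W μ x ∂ν := by
  obtain ⟨ε, hε, hμ, hfin, hloc⟩ := hmin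
  have iμ := hμ.1
  have iν := hν.1
  set C := ∫⁻ x, potential N W μ x ∂μ with hC
  set J := ∫⁻ x, potential N W μ x ∂ν with hJ
  set D := ∫⁻ x, potential N W ν x ∂ν with hD
  have hCfin : C ≠ ⊤ := by
    intro h
    have : interE N W μ = (1/2 : ℝ≥0∞) * C := rfl
    rw [this, h] at hfin
    simp at hfin
  by_contra hlt
  push Not at hlt
  have hJfin : J ≠ ⊤ := hlt.ne_top
  set Q := ∫⁻ p : Euc N × Euc N, ENNReal.ofReal (‖p.1 - p.2‖ ^ 2) ∂(ν.prod μ) with hQ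
  have hQfin : Q ≠ ⊤ := (cost_fin μ ν hμ hν).ne
  have key : ∀ t : ℝ, 0 < t → t < 1 → t * Q.toReal ≤ ε ^ 2 →
      C.toReal ≤ (1-t) * ((1-t) * C.toReal) + 2 * ((1-t) * (t * J.toReal)) +
        t * (t * D.toReal) := by
    intro t ht ht1 htQ
    set c := ENNReal.ofReal (1-t)
    set d := ENNReal.ofReal t
    have hcd : c + d = 1 := by
      rw [← ENNReal.ofReal_add (by linarith) ht.le]; simp
    have hp : IsProb2 N (c • μ + d • ν) := by
      refine ⟨⟨by simp [hcd]⟩, ?_⟩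
      rw [lintegral_add_measure, lintegral_smul_measure, lintegral_smul_measure]
      exact ENNReal.add_lt_top.2 ⟨ENNReal.mul_lt_top (by simp [c]) hμ.2,
          ENNReal.mul_lt_top (by simp [d]) hν.2⟩
    have hw : wass2 N (c • μ + d • ν) μ ≤ ENNReal.ofReal ε := by
      refine (wass_comb μ ν iμ iν c d hcd).trans ?_
      rw [← hQ, ← ENNReal.ofReal_toReal hQfin, ← ENNReal.ofReal_mul ht.le,
        ENNReal.ofReal_rpow_of_nonneg (by positivity) (by norm_num)]
      apply ENNReal.ofReal_le_ofReal
      rw [← Real.sqrt_eq_rpow]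
      exact Real.sqrt_le_iff.2 ⟨hε.le, htQ⟩
    have h := hloc _ hp hw
    have h' : (1/2 : ℝ≥0∞) * C ≤ (1/2 : ℝ≥0∞) *
      ∫⁻ x, potential N W (c • μ + d • ν) x ∂(c • μ + d • ν) := h
    rw [ENNReal.mul_le_mul_iff_right (by simp) (by simp), energy_comb hW hs] at h'
    have h1 : C.toReal ≤ (c * (c * C) + 2 * (c * (d * J)) + d * (d * D)).toReal :=
      ENNReal.toReal_mono (by finiteness) h'
    rw [ENNReal.toReal_add (by finiteness) (by finiteness),
      ENNReal.toReal_add (by finiteness) (by finiteness)] at h1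
    simpa [ENNReal.toReal_mul, c, d, ht.le, ENNReal.toReal_ofReal, (sub_pos.2 ht1).le] using h1
  have hlt' : J.toReal < C.toReal := (ENNReal.toReal_lt_toReal hJfin hCfin).2 hlt
  set M := |C.toReal - 2 * J.toReal + D.toReal| + 1
  have hM : 0 < M := by positivity
  set t := min (1/2) (min (ε^2 / (Q.toReal + 1)) ((C.toReal - J.toReal) / M)) with htdef
  have hQ0 : 0 ≤ Q.toReal := ENNReal.toReal_nonneg
  have ht0 : 0 < t := by
    refine lt_min (by norm_num) (lt_min (by positivity) (div_pos (by linarith) hM))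
  have ht1 : t ≤ 1/2 := min_le_left _ _
  have ht2 : t * (Q.toReal + 1) ≤ ε^2 := by
    rw [← le_div_iff₀ (by positivity)]
    exact (min_le_right _ _).trans (min_le_left _ _)
  have ht3 : t * M ≤ C.toReal - J.toReal := by
    rw [← le_div_iff₀ (by positivity)]
    exact (min_le_right _ _).trans (min_le_right _ _)
  have := key t ht0 (by linarith) (by nlinarith)
  have h5 : t * (C.toReal - 2 * J.toReal + D.toReal) ≤ t * M :=
    mul_le_mul_of_nonneg_left (by linarith [le_abs_self (C.toReal - 2 * J.toReal + D.toReal)]) ht0.le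
  have h6 : t * (2 * (C.toReal - J.toReal)) ≤ t * (t * (C.toReal - 2 * J.toReal + D.toReal)) := by
    nlinarith
  have h7 := le_of_mul_le_mul_left h6 ht0
  linarith

lemma cond_lint {N : ℕ} (μ : Measure (Euc N)) (A : Set (Euc N)) (f : Euc N → ℝ≥0∞) :
    ∫⁻ x, f x ∂(ProbabilityTheory.cond μ A) ≤ (μ A)⁻¹ * ∫⁻ x, f x ∂μ := by
  rw [ProbabilityTheory.cond, lintegral_smul_measure, smul_eq_mul]
  gcongr
  exact Measure.restrict_le_self

lemma cond_prob2 {N : ℕ} (μ : Measure (Euc N)) (A : Set (Euc N)) (hμ : IsProb2 N μ)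
    (hA : μ A ≠ 0) : IsProb2 N (ProbabilityTheory.cond μ A) := by
  have := hμ.1
  refine ⟨ProbabilityTheory.cond_isProbabilityMeasure hA, ?_⟩
  exact (cond_lint μ A _).trans_lt (ENNReal.mul_lt_top (by simpa [pos_iff_ne_zero] using hA) hμ.2)

lemma cond_energy {N : ℕ} {W : Euc N → ℝ≥0∞} (hW : Measurable W)
    (μ : Measure (Euc N)) [SFinite μ] (A : Set (Euc N)) 
    (hA : μ A ≠ 0) (hE : ∫⁻ x, potential N W μ x ∂μ ≠ ⊤) :
    ∫⁻ x, potential N W (ProbabilityTheory.cond μ A) x ∂(ProbabilityTheory.cond μ A) ≠ ⊤ := by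
  have h : ∫⁻ x, potential N W (ProbabilityTheory.cond μ A) x ∂(ProbabilityTheory.cond μ A)
      ≤ (μ A)⁻¹ * ((μ A)⁻¹ * ∫⁻ x, potential N W μ x ∂μ) := by
    refine (cond_lint μ A _).trans ?_
    gcongr
    rw [← lintegral_const_mul _ (pot_measurable hW μ)]
    exact lintegral_mono fun x => cond_lint μ A _
  refine ne_top_of_le_ne_top ?_ h
  have : (μ A)⁻¹ ≠ ⊤ := by simpa using hA
  finiteness

lemma pot_ae {N : ℕ} {W : Euc N → ℝ≥0∞} (hW : Measurable W) (hs : ∀ x, W (-x) = W x)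
    {μ : Measure (Euc N)} (hmin : IsLocalMin2 N W μ) :
    ∃ C : ℝ≥0∞, C ≠ ⊤ ∧ C = ∫⁻ x, potential N W μ x ∂μ ∧ ∀ᵐ x ∂μ, potential N W μ x = C := by
  have hmin' := hmin
  obtain ⟨ε, hε, hμ, hfin, hloc⟩ := hmin'
  have iμ := hμ.1
  have hCfin : ∫⁻ x, potential N W μ x ∂μ ≠ ⊤ := by
    intro h
    have : interE N W μ = (1/2 : ℝ≥0∞) * ∫⁻ x, potential N W μ x ∂μ := rfl
    rw [this, h] at hfin
    simp at hfin
  refine ⟨_, hCfin, rfl, ?_⟩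
  set C := ∫⁻ x, potential N W μ x ∂μ with hC
  have hm := pot_measurable hW μ
  have hle : ∀ᵐ x ∂μ, C ≤ potential N W μ x := by
    set A := {x | potential N W μ x < C} with hAdef
    have hAm : MeasurableSet A := measurableSet_lt hm measurable_const
    have hA0 : μ A = 0 := by
      by_contra hA
      have h1 := first_variation hW hs hmin _ (cond_prob2 μ A hμ hA) (cond_energy hW μ A hA hCfin)
      have i2 := ProbabilityTheory.cond_isProbabilityMeasure (μ := μ) hA
      have h2 : ∫⁻ x, potential N W μ x ∂(ProbabilityTheory.cond μ A) <
          ∫⁻ x, C ∂(ProbabilityTheory.cond μ A) := by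
        refine lintegral_strict_mono (IsProbabilityMeasure.ne_zero _) aemeasurable_const ?_ ?_
        · refine ne_top_of_le_ne_top ?_ (cond_lint μ A _)
          have : (μ A)⁻¹ ≠ ⊤ := by simpa using hA
          finiteness
        · exact ProbabilityTheory.ae_cond_mem hAm
      simp at h2
      exact absurd h1 (not_le.2 h2)
    have : ∀ᵐ x ∂μ, x ∉ A := measure_eq_zero_iff_ae_notMem.1 hA0
    filter_upwards [this] with x hx
    exact not_lt.1 hx
  have := ae_eq_of_ae_le_of_lintegral_le (f := fun _ => C) hle (by simpa using hCfin) hm.aemeasurable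
    (by simp [hC])
  filter_upwards [this] with x hx
  exact hx.symm

lemma pot_le_supp {N : ℕ} {W : Euc N → ℝ≥0∞} (hW : Continuous W)
    {μ : Measure (Euc N)} (C : ℝ≥0∞) (h : ∀ᵐ x ∂μ, potential N W μ x = C) :
    ∀ x ∈ μ.support, potential N W μ x ≤ C := by
  have hcl : IsClosed {x | potential N W μ x ≤ C} := by
    refine IsSeqClosed.isClosed ?_
    intro u x hu hx
    have h1 : ∀ y, W (x - y) = liminf (fun n => W (u n - y)) atTop := by
      intro y
      refine (Tendsto.liminf_eq ?_).symm
      exact (hW.tendsto _).comp (hx.sub_const y)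
    have h2 : potential N W μ x ≤ liminf (fun n => potential N W μ (u n)) atTop := by
      unfold potential
      simp_rw [h1]
      exact lintegral_liminf_le fun n => by fun_prop
    refine h2.trans ?_
    refine liminf_le_of_le (by isBoundedDefault) fun b hb => ?_
    obtain ⟨n, hn⟩ := hb.exists
    exact hn.trans (hu n)
  exact Measure.support_subset_of_isClosed hcl (h.mono fun x hx => hx.le)

/-- domination hypothesis -/
def DomHyp (N : ℕ) (W : Euc N → ℝ≥0∞) : Prop :=
  ∀ M l : ℝ, 0 < M → 0 < l → ∃ A : ℝ≥0∞, A ≠ ⊤ ∧ ∀ x z : Euc N, ‖z - x‖ ≤ M → ‖z‖ ≤ l * ‖x‖ →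
    W x ≤ A * (1 + W z)

lemma near {N : ℕ} {S : Set (Euc N)} (hS : IsClosed S) (hne : S.Nonempty) :
    ∃ P : Euc N → Euc N, ∀ x, P x ∈ S ∧ ∀ y ∈ S, ‖P x - x‖ ≤ ‖x - y‖ ∧ ‖P x - y‖ ≤ 2 * ‖x - y‖ := by
  choose P hP hd using fun x => hS.exists_infDist_eq_dist hne x
  refine ⟨P, fun x => ⟨hP x, fun y hy => ?_⟩⟩
  have h1 : ‖P x - x‖ ≤ ‖x - y‖ := by
    rw [← dist_eq_norm, ← dist_eq_norm, dist_comm, ← hd]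
    exact Metric.infDist_le_dist_of_mem hy
  refine ⟨h1, ?_⟩
  have : P x - y = (P x - x) + (x - y) := by abel
  rw [this]
  linarith [norm_add_le (P x - x) (x - y)]

lemma pratt {α ι : Type*} [MeasurableSpace α] {μ : Measure α} {l : Filter ι}
    [l.IsCountablyGenerated] {f g : ι → α → ℝ≥0∞} {F G : α → ℝ≥0∞}
    (hf : ∀ i, Measurable (f i)) (hg : ∀ i, Measurable (g i)) (hG : Measurable G)
    (hfg : ∀ i, ∀ᵐ y ∂μ, f i y ≤ g i y)
    (hF : ∀ y, Tendsto (fun i => f i y) l (𝓝 (F y)))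
    (hGl : ∀ y, Tendsto (fun i => g i y) l (𝓝 (G y)))
    (hFG : ∀ᵐ y ∂μ, F y ≤ G y)
    (hGfin : ∫⁻ y, G y ∂μ ≠ ⊤) (hint : ∀ i, ∫⁻ y, g i y ∂μ = ∫⁻ y, G y ∂μ) :
    Tendsto (fun i => ∫⁻ y, f i y ∂μ) l (𝓝 (∫⁻ y, F y ∂μ)) := by
  have h1 : Tendsto (fun i => ∫⁻ y, min (f i y) (G y) ∂μ) l (𝓝 (∫⁻ y, F y ∂μ)) := by
    refine tendsto_lintegral_filter_of_dominated_convergence G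
      (Eventually.of_forall fun i => (hf i).min hG)
      (Eventually.of_forall fun i => Eventually.of_forall fun y => min_le_right _ _) hGfin ?_
    filter_upwards [hFG] with y hy
    have := (hF y).min (tendsto_const_nhds (x := G y))
    rwa [min_eq_left hy] at this
  have h2 : Tendsto (fun i => ∫⁻ y, min (g i y) (G y) ∂μ) l (𝓝 (∫⁻ y, G y ∂μ)) := by
    refine tendsto_lintegral_filter_of_dominated_convergence G
      (Eventually.of_forall fun i => (hg i).min hG)
      (Eventually.of_forall fun i => Eventually.of_forall fun y => min_le_right _ _) hGfin ?_
    refine Eventually.of_forall fun y => ?_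
    have := (hGl y).min (tendsto_const_nhds (x := G y))
    rwa [min_self] at this
  have h3 : Tendsto (fun i => ∫⁻ y, min (f i y) (G y) ∂μ +
      (∫⁻ y, G y ∂μ - ∫⁻ y, min (g i y) (G y) ∂μ)) l (𝓝 (∫⁻ y, F y ∂μ)) := by
    have := h1.add (ENNReal.Tendsto.sub (tendsto_const_nhds (x := ∫⁻ y, G y ∂μ)) h2 (Or.inl hGfin))
    simpa using this
  refine tendsto_of_tendsto_of_tendsto_of_le_of_le h1 h3 ?_ ?_
  · intro i
    exact lintegral_mono fun y => min_le_left _ _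
  · intro i
    have h4 : ∫⁻ y, (g i y - G y) ∂μ ≤ ∫⁻ y, G y ∂μ - ∫⁻ y, min (g i y) (G y) ∂μ := by
      refine ENNReal.le_sub_of_add_le_left ?_ ?_
      · exact ne_top_of_le_ne_top hGfin (lintegral_mono fun y => min_le_right _ _)
      · rw [← hint i, ← lintegral_add_left ((hg i).min hG)]
        refine lintegral_mono fun y => ?_
        rcases le_total (g i y) (G y) with h | h
        · simp [h, tsub_eq_zero_of_le h]
        · simp [h, add_tsub_cancel_of_le h]
    refine le_trans ?_ (add_le_add_right h4 _)
    rw [← lintegral_add_left ((hf i).min hG)]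
    refine lintegral_mono_ae ?_
    filter_upwards [hfg i] with y hy
    rcases le_total (f i y) (G y) with h | h
    · simp [h]
    · simp only [min_eq_right h]
      calc f i y = G y + (f i y - G y) := (add_tsub_cancel_of_le h).symm
        _ ≤ _ := by gcongr

lemma pot_continuous {N : ℕ} {W : Euc N → ℝ≥0∞} (hW : Continuous W) (hdom : DomHyp N W)
    {μ : Measure (Euc N)} [IsProbabilityMeasure μ] (C : ℝ≥0∞) (hC : C ≠ ⊤)
    (h : ∀ x ∈ μ.support, potential N W μ x = C) : Continuous (potential N W μ) := by
  have hne : μ.support.Nonempty := Measure.nonempty_support (IsProbabilityMeasure.ne_zero _)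
  obtain ⟨P, hP⟩ := near (Measure.isClosed_support (μ := μ)) hne
  have hsupp : ∀ᵐ y ∂μ, y ∈ μ.support := Measure.support_mem_ae
  have hint : ∀ A : ℝ≥0∞, ∀ z ∈ μ.support, ∫⁻ y, A * (1 + W (z - y)) ∂μ = A * (1 + C) := by
    intro A z hz
    rw [lintegral_const_mul _ (by fun_prop), lintegral_add_left (by fun_prop)]
    have := h z hz
    unfold potential at this
    simp [this]
  rw [continuous_iff_continuousAt]
  intro x0
  by_cases hx0 : x0 ∈ μ.support
  · obtain ⟨A, hA, hAd⟩ := hdom 1 2 one_pos two_pos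
    have hPx0 : P x0 = x0 := by
      have := ((hP x0).2 x0 hx0).1
      simpa [sub_eq_zero] using this
    have hPt : Tendsto P (𝓝 x0) (𝓝 x0) := by
      rw [tendsto_iff_norm_sub_tendsto_zero]
      have : Tendsto (fun x => 2 * ‖x - x0‖) (𝓝 x0) (𝓝 0) := by
        have : Continuous (fun x => 2 * ‖x - x0‖) := by fun_prop
        simpa using this.tendsto x0
      exact squeeze_zero (fun _ => norm_nonneg _) (fun x => ((hP x).2 x0 hx0).2) this
    -- work on the subtype-free filter by modifying outside the unit ball
    let Z : Euc N → Euc N := fun x => if ‖x - x0‖ ≤ 1 then x else x0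
    have hZ : Z =ᶠ[𝓝 x0] id := by
      filter_upwards [Metric.closedBall_mem_nhds x0 one_pos] with x hx
      rw [mem_closedBall_iff_norm] at hx
      simp [Z, hx]
    have hZt : Tendsto Z (𝓝 x0) (𝓝 x0) := (tendsto_congr' hZ).2 tendsto_id
    have hZ1 : ∀ x, ‖Z x - x0‖ ≤ 1 := by
      intro x
      by_cases hx : ‖x - x0‖ ≤ 1 <;> simp [Z, hx]
    have hmain : Tendsto (fun x => ∫⁻ y, W (Z x - y) ∂μ) (𝓝 x0) (𝓝 (∫⁻ y, W (x0 - y) ∂μ)) := by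
      refine pratt (g := fun x y => A * (1 + W (P (Z x) - y))) (G := fun y => A * (1 + W (x0 - y)))
        (fun x => by fun_prop) (fun x => by fun_prop) (by fun_prop) ?_ ?_ ?_ ?_ ?_ ?_
      · intro x
        filter_upwards [hsupp] with y hy
        refine hAd _ _ ?_ ?_
        · have := ((hP (Z x)).2 x0 hx0).1.trans (hZ1 x)
          simpa using this
        · exact ((hP (Z x)).2 y hy).2
      · intro y
        exact (hW.tendsto _).comp (hZt.sub_const y)
      · intro y
        refine ENNReal.Tendsto.const_mul ?_ (Or.inr hA)
        refine Tendsto.const_add _ ?_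
        exact (hW.tendsto _).comp ((hPt.comp hZt).sub_const y)
      · refine Eventually.of_forall fun y => hAd _ _ (by simp) ?_
        linarith [norm_nonneg (x0 - y)]
      · rw [hint A x0 hx0]; finiteness
      · intro x
        rw [hint A x0 hx0, hint A _ (hP _).1]
    refine hmain.congr' ?_
    filter_upwards [hZ] with x hx
    simp [potential, hx]
  · obtain ⟨d, hd, hball⟩ := Metric.isOpen_iff.1 (Measure.isOpen_compl_support (μ := μ)) x0 hx0
    obtain ⟨x1, hx1⟩ := hne
    set M := ‖x1 - x0‖ + d with hM
    have hMpos : 0 < M := by positivity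
    obtain ⟨A, hA, hAd⟩ := hdom M (M / (d/2) + 1) hMpos (by positivity)
    refine tendsto_lintegral_filter_of_dominated_convergence (fun y => A * (1 + W (x1 - y)))
      (Eventually.of_forall fun x => by fun_prop) ?_ (by rw [hint A x1 hx1]; finiteness) ?_
    · filter_upwards [Metric.ball_mem_nhds x0 (half_pos hd)] with x hx
      rw [mem_ball_iff_norm] at hx
      filter_upwards [hsupp] with y hy
      have hb : d ≤ ‖x0 - y‖ := by
        by_contra hc
        push Not at hc
        exact hball (by rwa [Metric.mem_ball, dist_comm, dist_eq_norm]) hy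
      have hxy : d / 2 ≤ ‖x - y‖ := by
        have : x0 - y = (x - y) - (x - x0) := by abel
        rw [this] at hb
        linarith [norm_sub_le (x - y) (x - x0)]
      have h1 : ‖x1 - x‖ ≤ M := by
        have : x1 - x = (x1 - x0) - (x - x0) := by abel
        rw [this]
        linarith [norm_sub_le (x1 - x0) (x - x0)]
      refine hAd _ _ (by simpa using h1) ?_
      have : x1 - y = (x1 - x) + (x - y) := by abel
      rw [this, add_mul, one_mul]
      refine (norm_add_le _ _).trans (add_le_add_left (h1.trans ?_) _)
      rw [div_mul_eq_mul_div, le_div_iff₀ (by positivity)]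
      gcongr
    · exact Eventually.of_forall fun y => (hW.tendsto _).comp (tendsto_id.sub_const y)

/-- scaling hypothesis -/
def ScaleHyp (N : ℕ) (W : Euc N → ℝ≥0∞) : Prop :=
  ∃ (κ : ℝ → ℝ≥0∞) (A' : ℝ≥0∞), A' ≠ ⊤ ∧ ∀ r : ℝ, 0 < r → r ≤ 1 →
    κ r ≠ ⊤ ∧ ∀ z : Euc N, W (r • z) ≤ κ r * W z ∧ (‖z‖ ≤ 2 * r → κ r ≤ A' * W z)

lemma pot_ge_supp {N : ℕ} {W : Euc N → ℝ≥0∞} (hW : Continuous W) (hs : ∀ x, W (-x) = W x)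
    (hdom : DomHyp N W) (hsc : ScaleHyp N W) (h0 : W 0 = ⊤)
    {μ : Measure (Euc N)} (hmin : IsLocalMin2 N W μ) (C : ℝ≥0∞) (hC : C ≠ ⊤)
    (hCE : C = ∫⁻ x, potential N W μ x ∂μ)
    (hle : ∀ x ∈ μ.support, potential N W μ x ≤ C) (x0 : Euc N) (hx0 : x0 ∈ μ.support) :
    C ≤ potential N W μ x0 := by
  have hmin' := hmin
  obtain ⟨ε, hε, hμ, hfin, hloc⟩ := hmin'
  have iμ := hμ.1
  have hsupp : ∀ᵐ y ∂μ, y ∈ μ.support := Measure.support_mem_ae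
  obtain ⟨P, hP⟩ := near (Measure.isClosed_support (μ := μ)) ⟨x0, hx0⟩
  set S := Metric.closedBall x0 1 with hS
  have hμS : μ S ≠ 0 :=
    (((Measure.mem_support_iff_forall x0).1 hx0) S (Metric.closedBall_mem_nhds x0 one_pos)).ne'
  have hμS' : (μ S)⁻¹ ≠ ⊤ := by simpa using hμS
  set η := ProbabilityTheory.cond μ S with hη
  have iη : IsProbabilityMeasure η := ProbabilityTheory.cond_isProbabilityMeasure hμS
  have hEη : ∫⁻ x, potential N W η x ∂η ≠ ⊤ :=
    cond_energy hW.measurable μ S hμS (hCE ▸ hC)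
  have hηS : ∀ᵐ u ∂η, ‖u - x0‖ ≤ 1 := by
    filter_upwards [ProbabilityTheory.ae_cond_mem (μ := μ) (s := S) measurableSet_closedBall]
      with u hu
    rwa [hS, mem_closedBall_iff_norm] at hu
  obtain ⟨A, hA, hAd⟩ := hdom 2 2 two_pos two_pos
  obtain ⟨κ, A', hA', hκ⟩ := hsc
  have hint : ∀ z ∈ μ.support, ∫⁻ y, A * (1 + W (z - y)) ∂μ ≤ A * (1 + C) := by
    intro z hz
    rw [lintegral_const_mul _ (by fun_prop), lintegral_add_left (by fun_prop)]
    have := hle z hz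
    unfold potential at this
    simp only [lintegral_const, measure_univ, mul_one]
    gcongr
  set B := (μ S)⁻¹ * (A * (1 + C)) with hB
  have hBfin : B ≠ ⊤ := by finiteness
  have hBb : ∀ w : Euc N, ‖w‖ ≤ 2 → ∫⁻ u, W (w + (u - x0)) ∂η ≤ B := by
    intro w hw
    refine (cond_lint μ S _).trans ?_
    rw [hB]
    gcongr
    refine le_trans ?_ (hint (P (x0 - w)) (hP _).1)
    refine lintegral_mono_ae ?_
    filter_upwards [hsupp] with u hu
    rw [← hs]
    have : -(w + (u - x0)) = (x0 - w) - u := by abel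
    rw [this]
    refine hAd _ _ ?_ ((hP _).2 u hu).2
    have := ((hP (x0 - w)).2 x0 hx0).1
    have e : ‖x0 - w - x0‖ = ‖w‖ := by
      rw [← norm_neg]; congr 1; abel
    rw [e] at this
    simpa using this.trans hw
  -- the test measures
  have htest : ∀ r : ℝ, 0 < r → r ≤ 1 →
      C ≤ ∫⁻ y, (∫⁻ u, W ((x0 - y) + r • (u - x0)) ∂η) ∂μ := by
    intro r hr hr1
    set T : Euc N → Euc N := fun u => x0 + r • (u - x0) with hT
    have hTc : Continuous T := by fun_prop
    have hTm : Measurable T := hTc.measurable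
    have hp2 : IsProb2 N (η.map T) := by
      refine ⟨Measure.isProbabilityMeasure_map hTm.aemeasurable, ?_⟩
      rw [lintegral_map (by fun_prop) hTm]
      calc ∫⁻ u, ENNReal.ofReal (‖T u‖ ^ 2) ∂η
          ≤ ∫⁻ u, ENNReal.ofReal ((‖x0‖ + 1)^2) ∂η := by
            refine lintegral_mono_ae ?_
            filter_upwards [hηS] with u hu
            apply ENNReal.ofReal_le_ofReal
            gcongr
            refine (norm_add_le _ _).trans ?_
            gcongr
            rw [norm_smul, Real.norm_of_nonneg hr.le]
            exact mul_le_one₀ hr1 (norm_nonneg _) hu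
        _ < ⊤ := by simp
    have hE : ∫⁻ x, potential N W (η.map T) x ∂(η.map T) ≠ ⊤ := by
      have := hp2.1
      rw [lintegral_map (pot_measurable hW.measurable _) hTm]
      have hle : ∫⁻ u, potential N W (η.map T) (T u) ∂η ≤
          κ r * ∫⁻ u, potential N W η u ∂η := by
        rw [← lintegral_const_mul _ (pot_measurable hW.measurable _)]
        refine lintegral_mono fun u => ?_
        unfold potential
        rw [lintegral_map (by fun_prop) hTm, ← lintegral_const_mul _ (by fun_prop)]
        refine lintegral_mono fun v => ?_
        have : T u - T v = r • (u - v) := by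
          simp only [hT, smul_sub]; abel
        simp only [this]
        exact ((hκ r hr hr1).2 _).1
      exact ne_top_of_le_ne_top (ENNReal.mul_ne_top (hκ r hr hr1).1 hEη) hle
    have h1 := first_variation hW.measurable hs hmin _ hp2 hE
    rw [← hCE, lintegral_map (pot_measurable hW.measurable _) hTm] at h1
    refine h1.trans (le_of_eq ?_)
    unfold potential
    rw [lintegral_lintegral_swap]
    · refine lintegral_congr fun y => lintegral_congr fun u => ?_
      congr 1
      simp only [hT]; abel
    · refine Measurable.aemeasurable ?_
      unfold Function.uncurry
      fun_prop
  -- domination for large z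
  have hbig : ∀ r : ℝ, 0 < r → r ≤ 1 → ∀ z : Euc N, 2 * r ≤ ‖z‖ → ∀ v : Euc N, ‖v‖ ≤ 1 →
      W (z + r • v) ≤ A * (1 + W z) := by
    intro r hr hr1 z hz v hv
    have hrv : ‖r • v‖ ≤ r := by
      rw [norm_smul, Real.norm_of_nonneg hr.le]
      exact mul_le_of_le_one_right hr.le hv
    refine hAd _ _ ?_ ?_
    · simp only [sub_add_cancel_left, norm_neg]
      linarith
    · have := norm_sub_le (z + r • v) (r • v)
      simp only [add_sub_cancel_right] at this
      linarith
  have hlim : Tendsto (fun r : ℝ => ∫⁻ y, (∫⁻ u, W ((x0 - y) + r • (u - x0)) ∂η) ∂μ) (𝓝[>] 0)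
      (𝓝 (∫⁻ y, W (x0 - y) ∂μ)) := by
    have hψ : ∫⁻ y, W (x0 - y) ∂μ ≠ ⊤ := ne_top_of_le_ne_top hC (hle x0 hx0)
    have hr01 : ∀ᶠ r : ℝ in 𝓝[>] 0, 0 < r ∧ r ≤ 1 := by
      filter_upwards [Ioc_mem_nhdsGT (show (0:ℝ) < 1 by norm_num)] with r hr
      exact hr
    refine tendsto_lintegral_filter_of_dominated_convergence
      (fun y => (A + A' * B) * (1 + W (x0 - y))) ?_ ?_ ?_ ?_
    · refine Eventually.of_forall fun r => ?_
      exact Measurable.lintegral_prod_right'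
        (f := fun p : Euc N × Euc N => W ((x0 - p.1) + r • (p.2 - x0))) (by fun_prop)
    · filter_upwards [hr01] with r hr
      refine Eventually.of_forall fun y => ?_
      set z := x0 - y
      rcases le_or_gt (2 * r) ‖z‖ with hz | hz
      · calc ∫⁻ u, W (z + r • (u - x0)) ∂η ≤ ∫⁻ u, A * (1 + W z) ∂η := by
              refine lintegral_mono_ae ?_
              filter_upwards [hηS] with u hu
              exact hbig r hr.1 hr.2 z hz _ hu
          _ = A * (1 + W z) := by simp
          _ ≤ _ := by gcongr; exact le_self_add
      · calc ∫⁻ u, W (z + r • (u - x0)) ∂η ≤ ∫⁻ u, κ r * W (r⁻¹ • z + (u - x0)) ∂η := by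
              refine lintegral_mono fun u => ?_
              have : z + r • (u - x0) = r • (r⁻¹ • z + (u - x0)) := by
                rw [smul_add, smul_smul, mul_inv_cancel₀ hr.1.ne', one_smul]
              simp only [this]
              exact ((hκ r hr.1 hr.2).2 _).1
          _ = κ r * ∫⁻ u, W (r⁻¹ • z + (u - x0)) ∂η := lintegral_const_mul _ (by fun_prop)
          _ ≤ (A' * W z) * B := by
              gcongr
              · exact ((hκ r hr.1 hr.2).2 z).2 hz.le
              · refine hBb _ ?_
                rw [norm_smul, norm_inv, Real.norm_of_nonneg hr.1.le, inv_mul_le_iff₀ hr.1]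
                linarith
          _ = (A' * B) * W z := by ring
          _ ≤ _ := by
              gcongr
              · exact le_add_self
              · exact le_add_self
    · rw [lintegral_const_mul _ (by fun_prop), lintegral_add_left (by fun_prop)]
      simp only [lintegral_const, measure_univ, mul_one]
      finiteness
    · have hlt : ∀ᵐ y ∂μ, W (x0 - y) < ⊤ := ae_lt_top (by fun_prop) hψ
      filter_upwards [hlt] with y hy
      set z := x0 - y
      have hz : 0 < ‖z‖ := by
        rw [norm_pos_iff]
        intro h
        rw [h, h0] at hy
        exact lt_irrefl _ hy
      have hWz : ∫⁻ _ : Euc N, W z ∂η = W z := by simp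
      rw [← hWz]
      refine tendsto_lintegral_filter_of_dominated_convergence (fun _ => A * (1 + W z)) ?_ ?_ ?_ ?_
      · exact Eventually.of_forall fun r => by fun_prop
      · filter_upwards [hr01, Ioc_mem_nhdsGT (half_pos hz)] with r hr hr2
        filter_upwards [hηS] with u hu
        exact hbig r hr.1 hr.2 z (by linarith [hr2.2]) _ hu
      · have := hy.ne
        simp only [lintegral_const, measure_univ, mul_one]
        finiteness
      · refine Eventually.of_forall fun u => ?_
        have hc : Continuous (fun r : ℝ => W (z + r • (u - x0))) := by fun_prop
        have := (hc.tendsto 0).mono_left (nhdsWithin_le_nhds (s := Ioi 0))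
        simpa using this
  refine ge_of_tendsto hlim ?_
  filter_upwards [Ioc_mem_nhdsGT (show (0:ℝ) < 1 by norm_num)] with r hr
  exact htest r hr.1 hr.2

lemma kernel_le {p : ℝ} (hp : 0 < p) {X Z L : ℝ≥0∞} (hL0 : L ≠ 0) (hL : L ≠ ⊤)
    (h : Z ≤ L * X) : X ^ (-p) ≤ L ^ p * Z ^ (-p) := by
  have h1 : Z ^ p ≤ L ^ p * X ^ p := by
    rw [← ENNReal.mul_rpow_of_nonneg _ _ hp.le]
    exact ENNReal.rpow_le_rpow h hp.le
  have hLp0 : L ^ p ≠ 0 := by simp [ENNReal.rpow_eq_zero_iff, hL0, hL]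
  have hLp : L ^ p ≠ ⊤ := by finiteness
  rw [ENNReal.rpow_neg, ENNReal.rpow_neg]
  have h2 := ENNReal.inv_le_inv.2 h1
  rw [ENNReal.mul_inv (Or.inl hLp0) (Or.inl hLp)] at h2
  calc (X ^ p)⁻¹ = L ^ p * ((L ^ p)⁻¹ * (X ^ p)⁻¹) := by
        rw [← mul_assoc, ENNReal.mul_inv_cancel hLp0 hLp, one_mul]
    _ ≤ _ := by gcongr

lemma W_continuous (N : ℕ) (s a : ℝ) (hsN : 2 * s < (N : ℝ)) (ha : 0 < a) :
    Continuous (powerLawW N s a) := by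
  have key : ∀ f g : Euc N → ℝ≥0∞, Continuous f → Continuous g → Continuous fun x => f x + g x :=
    fun f g hf hg => hf.add hg
  refine key _ _ ?_ ?_
  · have h : Continuous fun x : Euc N => ‖x‖ ^ a / a :=
      (continuous_norm.rpow_const fun _ => Or.inr ha.le).div_const a
    exact ENNReal.continuous_ofReal.comp h
  · have h : Continuous fun x : Euc N => ENNReal.ofReal ‖x‖ ^ (2 * s - (N : ℝ)) :=
      ENNReal.continuous_rpow_const.comp (ENNReal.continuous_ofReal.comp continuous_norm)
    refine (ENNReal.continuous_div_const _ ?_).comp h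
    simpa using hsN

lemma W_dom (N : ℕ) (s a : ℝ) (hsN : 2 * s < (N : ℝ)) (ha : 0 < a) :
    DomHyp N (powerLawW N s a) := by
  intro M l hM hl
  set p := (N : ℝ) - 2 * s with hp
  have hp0 : 0 < p := by linarith
  have hneg : 2 * s - (N : ℝ) = -p := by ring
  refine ⟨ENNReal.ofReal (2 ^ a) * (ENNReal.ofReal (M ^ a / a) + 1) + ENNReal.ofReal l ^ p, ?_, ?_⟩
  · have : ENNReal.ofReal l ^ p ≠ ⊤ := ENNReal.rpow_ne_top_of_nonneg hp0.le (by simp)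
    finiteness
  intro x z hxz hz
  unfold powerLawW
  rw [← hp, hneg]
  have h1 : ENNReal.ofReal (‖x‖ ^ a / a) ≤
      ENNReal.ofReal (2 ^ a) * (ENNReal.ofReal (M ^ a / a) + ENNReal.ofReal (‖z‖ ^ a / a)) := by
    rw [← ENNReal.ofReal_add (by positivity) (by positivity), ← ENNReal.ofReal_mul (by positivity)]
    apply ENNReal.ofReal_le_ofReal
    rw [← add_div, ← mul_div_assoc]
    gcongr
    have hx : ‖x‖ ≤ M + ‖z‖ := by
      have := norm_sub_le z (z - x)
      rw [show z - (z - x) = x by abel] at this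
      linarith
    have hx2 : ‖x‖ ≤ 2 * max M ‖z‖ := by
      linarith [le_max_left M ‖z‖, le_max_right M ‖z‖]
    calc ‖x‖ ^ a ≤ (2 * max M ‖z‖) ^ a := Real.rpow_le_rpow (norm_nonneg _) hx2 ha.le
      _ = 2 ^ a * (max M ‖z‖) ^ a := Real.mul_rpow (by norm_num) (by positivity)
      _ ≤ _ := by
        gcongr
        rcases le_total M ‖z‖ with h | h
        · rw [max_eq_right h]
          linarith [Real.rpow_nonneg hM.le a]
        · rw [max_eq_left h]
          linarith [Real.rpow_nonneg (norm_nonneg z) a]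
  have h2 : ENNReal.ofReal ‖x‖ ^ (-p) ≤ ENNReal.ofReal l ^ p * ENNReal.ofReal ‖z‖ ^ (-p) := by
    refine kernel_le hp0 (by simpa using hl) (by simp) ?_
    rw [← ENNReal.ofReal_mul hl.le]
    exact ENNReal.ofReal_le_ofReal hz
  have h3 : ENNReal.ofReal ‖x‖ ^ (-p) / ENNReal.ofReal p ≤
      ENNReal.ofReal l ^ p * (ENNReal.ofReal ‖z‖ ^ (-p) / ENNReal.ofReal p) := by
    rw [← mul_div_assoc]
    gcongr
  refine (add_le_add h1 h3).trans ?_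
  set α := ENNReal.ofReal (2 ^ a)
  set m := ENNReal.ofReal (M ^ a / a)
  set v := ENNReal.ofReal (‖z‖ ^ a / a)
  set L := ENNReal.ofReal l ^ p
  set k := ENNReal.ofReal ‖z‖ ^ (-p) / ENNReal.ofReal p
  have : (α * (m + 1) + L) * (1 + (v + k)) =
    (α * (m + v) + L * k) + (α * m * (v + k) + α + α * k + L + L * v) := by ring
  rw [this]
  exact le_self_add

lemma W_scale (N : ℕ) (s a : ℝ) (hsN : 2 * s < (N : ℝ)) (ha : 0 < a) :
    ScaleHyp N (powerLawW N s a) := by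
  set p := (N : ℝ) - 2 * s with hp
  have hp0 : 0 < p := by linarith
  have hneg : 2 * s - (N : ℝ) = -p := by ring
  have hP0 : ENNReal.ofReal p ≠ 0 := by simpa using hp0
  refine ⟨fun r => ENNReal.ofReal r ^ (-p), 2 ^ p * ENNReal.ofReal p, ?_, ?_⟩
  · have : (2 : ℝ≥0∞) ^ p ≠ ⊤ := ENNReal.rpow_ne_top_of_nonneg hp0.le (by simp)
    finiteness
  intro r hr hr1
  have hr0 : ENNReal.ofReal r ≠ 0 := by simpa using hr
  have hrp0 : ENNReal.ofReal r ^ p ≠ 0 := by simp [ENNReal.rpow_eq_zero_iff, hr]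
  have hrp : ENNReal.ofReal r ^ p ≠ ⊤ := ENNReal.rpow_ne_top_of_nonneg hp0.le (by simp)
  refine ⟨?_, fun z => ⟨?_, fun hz => ?_⟩⟩
  · change ENNReal.ofReal r ^ (-p) ≠ ⊤
    rw [ENNReal.rpow_neg]; simpa using hrp0
  · unfold powerLawW
    rw [← hp, hneg, mul_add, ← mul_div_assoc]
    have hn : ‖r • z‖ = r * ‖z‖ := by rw [norm_smul, Real.norm_of_nonneg hr.le]
    refine add_le_add ?_ ?_
    · have h1 : 1 ≤ ENNReal.ofReal r ^ (-p) := by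
        rw [ENNReal.rpow_neg, ENNReal.one_le_inv]
        exact ENNReal.rpow_le_one (by simpa using hr1) hp0.le
      refine le_trans ?_ (le_mul_of_one_le_left (zero_le) h1)
      apply ENNReal.ofReal_le_ofReal
      gcongr
      rw [hn]
      exact mul_le_of_le_one_left (norm_nonneg _) hr1
    · gcongr
      change _ ≤ ENNReal.ofReal r ^ (-p) * _
      rw [hn, ENNReal.ofReal_mul hr.le, ENNReal.rpow_neg, ENNReal.rpow_neg, ENNReal.rpow_neg,
        ENNReal.mul_rpow_of_nonneg _ _ hp0.le, ENNReal.mul_inv (Or.inl hrp0) (Or.inl hrp)]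
  · have h1 : ENNReal.ofReal r ^ (-p) ≤ 2 ^ p * ENNReal.ofReal ‖z‖ ^ (-p) := by
      refine kernel_le hp0 (by simp) (by simp) ?_
      have := ENNReal.ofReal_le_ofReal hz
      rwa [ENNReal.ofReal_mul (by norm_num), ENNReal.ofReal_ofNat] at this
    refine h1.trans ?_
    rw [mul_assoc]
    refine mul_le_mul_right ?_ _
    unfold powerLawW
    rw [← hp, hneg, mul_add, ENNReal.mul_div_cancel hP0 (by simp)]
    exact le_add_self

lemma W_zero (N : ℕ) (s a : ℝ) (hsN : 2 * s < (N : ℝ)) : powerLawW N s a 0 = ⊤ := by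
  unfold powerLawW
  have : 2 * s - (N : ℝ) < 0 := by linarith
  simp [ENNReal.zero_rpow_of_neg this, ENNReal.top_div]

/-- **Continuity of the potential of local minimizers for power-law repulsion.**
For `W(x) = |x|^a/a − |x|^{2s−N}/(2s−N)` with `a > 0`, `0 < s ≤ 1`, `2s < N`,
the potential `ψ = W∗μ` of any `d₂`-local minimizer `μ` of the interaction energy
is a continuous function from `ℝ^N` to `[0,∞]`. -/
theorem potential_of_local_minimizer_continuous
    (N : ℕ) (hN : 1 ≤ N) (s a : ℝ) (hs0 : 0 < s) (hs1 : s ≤ 1) (hsN : 2 * s < (N : ℝ))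
    (ha : 0 < a)
    (μ : Measure (Euc N)) (hmin : IsLocalMin2 N (powerLawW N s a) μ) :
    Continuous (potential N (powerLawW N s a) μ) := by
  have hc := W_continuous N s a hsN ha
  have hsymm : ∀ x, powerLawW N s a (-x) = powerLawW N s a x := fun x => by
    simp [powerLawW]
  have hdom := W_dom N s a hsN ha
  obtain ⟨C, hC, hCE, hae⟩ := pot_ae hc.measurable hsymm hmin
  have hle := pot_le_supp hc C hae
  have hge := pot_ge_supp hc hsymm hdom (W_scale N s a hsN ha) (W_zero N s a hsN) hmin C hC hCE hle
  obtain ⟨ε, hε, hμ, -⟩ := hmin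
  have := hμ.1
  exact pot_continuous hc hdom C hC fun x hx => le_antisymm (hle x hx) (hge x hx)
end

section
/- Characterization of global minimizers for Newtonian repulsion with quadratic attraction: Let N ≥ 3 and W(x) = |x|²/2 − |x|^{2−N}/(2−N) = |x|²/2 + |x|^{2−N}/(N−2). Then there exists R > 0 such that a measure μ ∈ 𝒫₂(ℝ^N) is a global minimizer of the interaction energy E over 𝒫₂(ℝ^N) if and only if μ is a translate of the uniform probability measure on a Euclidean ball of radius R, i.e. μ has density |B_R|^{−1} 𝟙_{B_R(x₀)} with respect to Lebesgue measure for some x₀ ∈ ℝ^N. -/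
open MeasureTheory Real Set Filter ENNReal

/-- The potential with quadratic attraction and Newtonian repulsion,
`W(x) = |x|²/2 + |x|^{2−N}/(N−2)`, valued in `[0,∞]` (equal to `∞` at `x = 0`
since `2 − N < 0` for `N ≥ 3`). -/
noncomputable def newtQuadW (N : ℕ) (x : Euc N) : ℝ≥0∞ :=
  ENNReal.ofReal (‖x‖ ^ 2 / 2) +
    (ENNReal.ofReal ‖x‖) ^ ((2 : ℝ) - (N : ℝ)) / ENNReal.ofReal ((N : ℝ) - 2)

/-- Regularised Newtonian kernel. -/
noncomputable def nqH (N : ℕ) (e : ℝ) (z : Euc N) : ℝ :=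
  (‖z‖ ^ 2 + e ^ 2) ^ (1 - (N : ℝ) / 2) / ((N : ℝ) - 2)

noncomputable def nqRho (N : ℕ) (e : ℝ) (z : Euc N) : ℝ :=
  (‖z‖ ^ 2 + e ^ 2) ^ (-((N : ℝ) / 2))

noncomputable def nqDel (N : ℕ) (e : ℝ) (z : Euc N) : ℝ :=
  N * e ^ 2 * (‖z‖ ^ 2 + e ^ 2) ^ (-((N : ℝ) / 2) - 1)

noncomputable def nqPhi (N : ℕ) (y : Euc N) : ℝ := (1 - (min ‖y‖ 1) ^ 2) / 2

lemma nq_pos {N : ℕ} {e : ℝ} (he : 0 < e) (z : Euc N) : 0 < ‖z‖ ^ 2 + e ^ 2 := by positivity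

lemma nqH_cont {N : ℕ} {e : ℝ} (he : 0 < e) : Continuous (nqH N e) := by
  unfold nqH
  refine Continuous.div_const (Continuous.rpow_const (by fun_prop) fun z => Or.inl (nq_pos he z).ne') _

lemma nqRho_cont {N : ℕ} {e : ℝ} (he : 0 < e) : Continuous (nqRho N e) := by
  unfold nqRho
  refine (Continuous.rpow_const (by fun_prop) fun z => Or.inl (nq_pos he z).ne')

lemma nqDel_cont {N : ℕ} {e : ℝ} (he : 0 < e) : Continuous (nqDel N e) := by
  unfold nqDel
  refine Continuous.mul (by fun_prop) (Continuous.rpow_const (by fun_prop) fun z => Or.inl (nq_pos he z).ne')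

lemma nqRho_hasFDerivAt {N : ℕ} {e : ℝ} (he : 0 < e) (z : Euc N) :
    HasFDerivAt (nqRho N e)
      ((-(N : ℝ) * (‖z‖ ^ 2 + e ^ 2) ^ (-((N : ℝ) / 2) - 1)) • innerSL ℝ z) z := by
  unfold nqRho
  have h1 : HasFDerivAt (fun z : Euc N => ‖z‖ ^ 2 + e ^ 2) (2 • innerSL ℝ z) z :=
    (hasStrictFDerivAt_norm_sq z).hasFDerivAt.add_const _
  have h2 := h1.rpow_const (p := -((N : ℝ) / 2)) (Or.inl (nq_pos he z).ne')
  convert! h2 using 1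
  ext v
  simp
  ring

lemma nqH_hasFDerivAt {N : ℕ} (hN : 3 ≤ N) {e : ℝ} (he : 0 < e) (z : Euc N) :
    HasFDerivAt (nqH N e) ((-nqRho N e z) • innerSL ℝ z) z := by
  unfold nqH nqRho
  have h1 : HasFDerivAt (fun z : Euc N => ‖z‖ ^ 2 + e ^ 2) (2 • innerSL ℝ z) z :=
    (hasStrictFDerivAt_norm_sq z).hasFDerivAt.add_const _
  have h2 := (h1.rpow_const (p := 1 - ((N : ℝ) / 2)) (Or.inl (nq_pos he z).ne')).mul_const
    ((N : ℝ) - 2)⁻¹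
  have hN' : (N : ℝ) - 2 ≠ 0 := by
    have : (3 : ℝ) ≤ N := by exact_mod_cast hN
    linarith
  convert! h2 using 1
  ext v
  simp
  field_simp
  ring

lemma nq_ftc {N : ℕ} (hN : 3 ≤ N) {e : ℝ} (he : 0 < e) (x y : Euc N) :
    ∫ r in (0:ℝ)..1, nqRho N e (x - r • y) * inner ℝ (x - r • y) y = nqH N e (x - y) - nqH N e x := by
  have key : ∀ r ∈ uIcc (0:ℝ) 1, HasDerivAt (fun r : ℝ => nqH N e (x - r • y))
      (nqRho N e (x - r • y) * inner ℝ (x - r • y) y) r := by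
    intro r _
    have h1 : HasDerivAt (fun r : ℝ => x - r • y) (-y) r := by
      simpa using ((hasDerivAt_id r).smul_const y).const_sub x
    have h2 := (nqH_hasFDerivAt hN he (x - r • y)).comp_hasDerivAt r h1
    convert! h2 using 1
    simp only [FunLike.coe_smul, Pi.smul_apply, innerSL_apply_apply, inner_neg_right, smul_eq_mul]
    ring
  rw [intervalIntegral.integral_eq_sub_of_hasDerivAt key]
  · simp
  · apply Continuous.intervalIntegrable
    have := nqRho_cont (N := N) he
    fun_prop

lemma nqPhi_lip (N : ℕ) : LipschitzWith 1 (nqPhi N) := by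
  refine LipschitzWith.of_dist_le_mul fun a b => ?_
  have h1 : |min ‖a‖ 1 - min ‖b‖ 1| ≤ ‖a - b‖ := by
    have := abs_min_sub_min_le_max ‖a‖ 1 ‖b‖ 1
    exact (this.trans (max_le (abs_norm_sub_norm_le a b) (by simp)))
  have ha : 0 ≤ min ‖a‖ 1 := by positivity
  have hb : 0 ≤ min ‖b‖ 1 := by positivity
  have ha1 : min ‖a‖ 1 ≤ 1 := min_le_right _ _
  have hb1 : min ‖b‖ 1 ≤ 1 := min_le_right _ _
  rw [Real.dist_eq, dist_eq_norm]
  unfold nqPhi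
  rw [show (1 - (min ‖a‖ 1) ^ 2) / 2 - (1 - (min ‖b‖ 1) ^ 2) / 2 =
    - ((min ‖a‖ 1 - min ‖b‖ 1) * ((min ‖a‖ 1 + min ‖b‖ 1) / 2)) by ring, abs_neg, abs_mul]
  have : |(min ‖a‖ 1 + min ‖b‖ 1) / 2| ≤ 1 := by
    rw [abs_of_nonneg (by positivity)]; linarith
  simp only [NNReal.coe_one, one_mul]
  nlinarith [abs_nonneg (min ‖a‖ 1 - min ‖b‖ 1)]

lemma nqPhi_nonneg {N : ℕ} (y : Euc N) : 0 ≤ nqPhi N y := by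
  unfold nqPhi
  have ha : 0 ≤ min ‖y‖ 1 := by positivity
  have ha1 : min ‖y‖ 1 ≤ 1 := min_le_right _ _
  nlinarith

lemma nqPhi_le {N : ℕ} (y : Euc N) : nqPhi N y ≤ 1 / 2 := by
  unfold nqPhi
  nlinarith [sq_nonneg (min ‖y‖ 1)]

lemma nqPhi_zero {N : ℕ} {y : Euc N} (h : 1 ≤ ‖y‖) : nqPhi N y = 0 := by
  simp [nqPhi, min_eq_right h]

lemma nqPhi_in {N : ℕ} {y : Euc N} (h : ‖y‖ ≤ 1) : nqPhi N y = (1 - ‖y‖ ^ 2) / 2 := by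
  simp [nqPhi, min_eq_left h]

lemma nqPhi_supp (N : ℕ) : HasCompactSupport (nqPhi N) := by
  refine HasCompactSupport.intro (isCompact_closedBall (0 : Euc N) 1) fun y hy => ?_
  apply nqPhi_zero
  simp at hy
  exact hy.le

lemma nqPhi_int (N : ℕ) : Integrable (nqPhi N) :=
  (nqPhi_lip N).continuous.integrable_of_hasCompactSupport (nqPhi_supp N)

lemma nqPhi_lineDeriv {N : ℕ} (v : Euc N) :
    ∀ᵐ y : Euc N, lineDeriv ℝ (nqPhi N) y v =
      (Metric.ball (0 : Euc N) 1).indicator (fun y => - inner ℝ y v) y := by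
  have hs : (volume : Measure (Euc N)) (Metric.sphere 0 1) = 0 :=
    Measure.addHaar_sphere_of_ne_zero _ _ one_ne_zero
  filter_upwards [compl_mem_ae_iff.2 hs] with y hy
  rcases lt_trichotomy ‖y‖ 1 with h | h | h
  · rw [indicator_of_mem (by simpa using h)]
    have h1 : HasFDerivAt (fun z : Euc N => (1 - ‖z‖ ^ 2) * (2:ℝ)⁻¹) _ y :=
      ((hasStrictFDerivAt_norm_sq y).hasFDerivAt.const_sub 1).mul_const _
    have h2 : nqPhi N =ᶠ[nhds y] (fun z : Euc N => (1 - ‖z‖ ^ 2) * (2:ℝ)⁻¹) := by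
      have : ∀ᶠ z in nhds y, ‖z‖ < 1 := continuous_norm.continuousAt.eventually_lt_const h
      filter_upwards [this] with z hz
      rw [nqPhi_in hz.le, div_eq_mul_inv]
    rw [((h1.congr_of_eventuallyEq h2).hasLineDerivAt v).lineDeriv]
    simp
  · exact absurd (by simpa using h) hy
  · rw [indicator_of_notMem (by simpa using h.le)]
    have h2 : nqPhi N =ᶠ[nhds y] (fun z : Euc N => (0:ℝ)) := by
      have : ∀ᶠ z in nhds y, 1 < ‖z‖ := continuous_norm.continuousAt.eventually_const_lt h
      filter_upwards [this] with z hz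
      rw [nqPhi_zero hz.le]
    rw [(((hasFDerivAt_const (0:ℝ) y).congr_of_eventuallyEq h2).hasLineDerivAt v).lineDeriv]
    simp

/-- component of the vector field -/
lemma nqP_hasFDerivAt {N : ℕ} {e : ℝ} (he : 0 < e) (x : Euc N) (r : ℝ) (v y : Euc N) :
    HasFDerivAt (fun y => nqRho N e (x - r • y) * inner ℝ (x - r • y) v)
      ((-r) • (nqRho N e (x - r • y) • innerSL ℝ v +
       (inner ℝ (x - r • y) v * (-(N : ℝ) * (‖x - r • y‖ ^ 2 + e ^ 2) ^ (-((N : ℝ) / 2) - 1))) •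
        innerSL ℝ (x - r • y))) y := by
  have h1 : HasFDerivAt (fun y : Euc N => x - r • y) (-(r • ContinuousLinearMap.id ℝ (Euc N))) y :=
    ((hasFDerivAt_id y).const_smul r).const_sub x
  have h2 := (nqRho_hasFDerivAt he (x - r • y)).comp y h1
  have h3 := ((innerSL ℝ v).hasFDerivAt (x := x - r • y)).comp y h1
  have h4 := h2.mul h3
  have : (fun y => nqRho N e (x - r • y) * inner ℝ (x - r • y) v) =
    (nqRho N e ∘ fun y => x - r • y) * (⇑((innerSL ℝ) v) ∘ fun y => x - r • y) := by
    ext y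
    simp [real_inner_comm]
  rw [this]
  convert! h4 using 1
  ext w
  simp [real_inner_comm]
  ring

lemma nqP_lip {N : ℕ} {e : ℝ} (he : 0 < e) (x : Euc N) (r : ℝ) (v : Euc N) :
    ∃ C, LipschitzWith C (fun y => nqRho N e (x - r • y) * inner ℝ (x - r • y) v) := by
  set C : ℝ := |r| * ((e ^ 2) ^ (-((N : ℝ) / 2)) * ‖v‖ + N * ‖v‖ * (e ^ 2) ^ (-((N : ℝ) / 2)))
  have hC : 0 ≤ C := by positivity
  refine ⟨C.toNNReal, lipschitzWith_of_nnnorm_fderiv_le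
    (fun y => (nqP_hasFDerivAt he x r v y).differentiableAt) fun y => ?_⟩
  rw [(nqP_hasFDerivAt he x r v y).fderiv]
  rw [← NNReal.coe_le_coe, coe_nnnorm, Real.coe_toNNReal _ hC]
  set z := x - r • y
  have hp := nq_pos he z
  have hb : (‖z‖ ^ 2 + e ^ 2) ^ (-((N : ℝ) / 2)) ≤ (e ^ 2) ^ (-((N : ℝ) / 2)) :=
    Real.rpow_le_rpow_of_nonpos (by positivity) (by nlinarith [sq_nonneg ‖z‖])
      (by have : (0:ℝ) ≤ N := by positivity
          linarith)
  have hb2 : (‖z‖ ^ 2) * (‖z‖ ^ 2 + e ^ 2) ^ (-((N : ℝ) / 2) - 1) ≤ (e ^ 2) ^ (-((N : ℝ) / 2)) := by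
    refine le_trans ?_ hb
    rw [Real.rpow_sub hp, Real.rpow_one, mul_div_assoc', div_le_iff₀ hp, mul_comm]
    gcongr
    nlinarith
  rw [norm_smul, norm_neg, Real.norm_eq_abs]
  refine mul_le_mul_of_nonneg_left ((norm_add_le _ _).trans (add_le_add ?_ ?_)) (abs_nonneg _)
  · rw [norm_smul, innerSL_apply_norm, Real.norm_eq_abs, abs_of_nonneg (by unfold nqRho; positivity)]
    unfold nqRho
    gcongr
  · rw [norm_smul, innerSL_apply_norm, norm_mul, norm_mul, norm_neg, Real.norm_eq_abs, Real.norm_eq_abs,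
      Real.norm_eq_abs, Nat.abs_cast, abs_of_pos (Real.rpow_pos_of_pos hp _)]
    calc _ ≤ (‖z‖ * ‖v‖) * (N * (‖z‖ ^ 2 + e ^ 2) ^ (-((N : ℝ) / 2) - 1)) * ‖z‖ := by
          gcongr
          exact abs_real_inner_le_norm _ _
      _ = N * ‖v‖ * ((‖z‖ ^ 2) * (‖z‖ ^ 2 + e ^ 2) ^ (-((N : ℝ) / 2) - 1)) := by ring
      _ ≤ _ := by gcongr

lemma nq_ibp1 {N : ℕ} {e : ℝ} (he : 0 < e) (x : Euc N) (r : ℝ) (v : Euc N) :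
    ∫ y in Metric.ball (0 : Euc N) 1, (nqRho N e (x - r • y) * inner ℝ (x - r • y) v) * inner ℝ y v
    = ∫ y, ((-r) * (nqRho N e (x - r • y) * ‖v‖ ^ 2 +
       (inner ℝ (x - r • y) v * (-(N : ℝ) * (‖x - r • y‖ ^ 2 + e ^ 2) ^ (-((N : ℝ) / 2) - 1))) *
        inner ℝ (x - r • y) v)) * nqPhi N y := by
  obtain ⟨C, hC⟩ := nqP_lip he x r v
  have h := hC.integral_lineDeriv_mul_eq (μ := volume) (nqPhi_lip N) (nqPhi_supp N) v
  rw [← integral_indicator measurableSet_ball]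
  convert! h.symm using 1
  · apply integral_congr_ae
    filter_upwards [nqPhi_lineDeriv (N := N) (-v)] with y hy
    rw [hy]
    by_cases hy1 : y ∈ Metric.ball (0 : Euc N) 1
    · rw [indicator_of_mem hy1, indicator_of_mem hy1]
      simp
      ring
    · rw [indicator_of_notMem hy1, indicator_of_notMem hy1]
      simp
  · apply integral_congr_ae
    filter_upwards with y
    rw [((nqP_hasFDerivAt he x r v y).hasLineDerivAt v).lineDeriv]
    simp [inner_sub_left, inner_smul_left, real_inner_comm]
    ring


lemma nqRho_eq {N : ℕ} {e : ℝ} (he : 0 < e) (z : Euc N) :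
    nqRho N e z = (‖z‖ ^ 2 + e ^ 2) * (‖z‖ ^ 2 + e ^ 2) ^ (-((N : ℝ) / 2) - 1) := by
  unfold nqRho
  rw [Real.rpow_sub (nq_pos he z), Real.rpow_one]
  have := (nq_pos he z).ne'
  field_simp

lemma nq_contS {N : ℕ} {e : ℝ} (he : 0 < e) :
    Continuous (fun z : Euc N => (‖z‖ ^ 2 + e ^ 2) ^ (-((N : ℝ) / 2) - 1)) :=
  (Continuous.rpow_const (by fun_prop) fun z => Or.inl (nq_pos he z).ne')

lemma nq_ibp {N : ℕ} {e : ℝ} (he : 0 < e) (x : Euc N) (r : ℝ) :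
    ∫ y in Metric.ball (0 : Euc N) 1, nqRho N e (x - r • y) * inner ℝ (x - r • y) y
    = - (r * ∫ y, nqPhi N y * nqDel N e (x - r • y)) := by
  set b := EuclideanSpace.basisFun (Fin N) ℝ
  have hc := nqRho_cont (N := N) he
  have hS := nq_contS (N := N) he
  have hP := (nqPhi_lip N).continuous
  have e1 : ∀ y : Euc N, nqRho N e (x - r • y) * inner ℝ (x - r • y) y =
      ∑ i, (nqRho N e (x - r • y) * inner ℝ (x - r • y) (b i)) * inner ℝ y (b i) := by
    intro y
    rw [← b.sum_inner_mul_inner, Finset.mul_sum]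
    refine Finset.sum_congr rfl fun i _ => ?_
    rw [real_inner_comm y (b i)]
    ring
  have e2 : ∀ y : Euc N, ∑ i, ((-r) * (nqRho N e (x - r • y) * ‖b i‖ ^ 2 +
       (inner ℝ (x - r • y) (b i) * (-(N : ℝ) * (‖x - r • y‖ ^ 2 + e ^ 2) ^ (-((N : ℝ) / 2) - 1))) *
        inner ℝ (x - r • y) (b i))) * nqPhi N y = (-r) * (nqPhi N y * nqDel N e (x - r • y)) := by
    intro y
    set z := x - r • y
    have h1 : ∑ i, inner ℝ z (b i) * inner ℝ z (b i) = ‖z‖ ^ 2 := by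
      rw [← real_inner_self_eq_norm_sq, ← b.sum_inner_mul_inner]
      refine Finset.sum_congr rfl fun i _ => ?_
      rw [real_inner_comm z (b i)]
    rw [← Finset.sum_mul, ← Finset.mul_sum, Finset.sum_add_distrib]
    have h2 : ∑ i, inner ℝ z (b i) * (-(N : ℝ) * (‖z‖ ^ 2 + e ^ 2) ^ (-((N : ℝ) / 2) - 1)) *
        inner ℝ z (b i) = (-(N : ℝ) * (‖z‖ ^ 2 + e ^ 2) ^ (-((N : ℝ) / 2) - 1)) * ‖z‖ ^ 2 := by
      rw [← h1, Finset.mul_sum]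
      refine Finset.sum_congr rfl fun i _ => ?_
      ring
    rw [h2]
    simp only [b.norm_eq_one, Finset.sum_const, Finset.card_univ, Fintype.card_fin, nsmul_eq_mul]
    rw [nqRho_eq he, nqDel]
    ring
  calc _ = ∑ i, ∫ y in Metric.ball (0 : Euc N) 1,
        (nqRho N e (x - r • y) * inner ℝ (x - r • y) (b i)) * inner ℝ y (b i) := by
        simp_rw [e1]
        refine integral_finsetSum _ fun i _ => ?_
        refine IntegrableOn.mono_set ?_ Metric.ball_subset_closedBall
        refine ContinuousOn.integrableOn_compact (isCompact_closedBall _ _) ?_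
        apply Continuous.continuousOn
        fun_prop
    _ = _ := by
        simp_rw [nq_ibp1 he]
        rw [← integral_finsetSum, ← integral_const_mul, ← integral_neg]
        · congr 1
          ext y
          rw [e2]
          ring
        · intro i _
          refine Continuous.integrable_of_hasCompactSupport ?_ ((nqPhi_supp N).mul_left)
          have hS2 : Continuous (fun y : Euc N =>
              (‖x - r • y‖ ^ 2 + e ^ 2) ^ (-((N : ℝ) / 2) - 1)) :=
            hS.comp (by fun_prop : Continuous fun y : Euc N => x - r • y)
          have hR2 : Continuous (fun y : Euc N => nqRho N e (x - r • y)) := by fun_prop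
          have hi : Continuous (fun y : Euc N => inner ℝ (x - r • y) (b i)) := by fun_prop
          exact ((continuous_const.mul ((hR2.mul continuous_const).add
            ((hi.mul (continuous_const.mul hS2)).mul hi))).mul hP)

lemma nq_identity {N : ℕ} (hN : 3 ≤ N) {e : ℝ} (he : 0 < e) (x : Euc N) :
    ∫ y in Metric.ball (0 : Euc N) 1, nqH N e (x - y) =
      volume.real (Metric.ball (0 : Euc N) 1) * nqH N e x -
        ∫ r in (0:ℝ)..1, r * ∫ y, nqPhi N y * nqDel N e (x - r • y) := by
  have hc := nqRho_cont (N := N) he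
  have hH := nqH_cont (N := N) he
  have h1 : ∫ y in Metric.ball (0 : Euc N) 1, (nqH N e (x - y) - nqH N e x) =
      ∫ r in (0:ℝ)..1, ∫ y in Metric.ball (0 : Euc N) 1,
        nqRho N e (x - r • y) * inner ℝ (x - r • y) y := by
    simp_rw [← nq_ftc hN he]
    rw [intervalIntegral_integral_swap]
    rw [uIoc_of_le zero_le_one, Measure.prod_restrict, ← IntegrableOn]
    refine IntegrableOn.mono_set (t := Icc (0:ℝ) 1 ×ˢ Metric.closedBall (0 : Euc N) 1) ?_
      (prod_mono Ioc_subset_Icc_self Metric.ball_subset_closedBall)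
    refine ContinuousOn.integrableOn_compact (isCompact_Icc.prod (isCompact_closedBall _ _)) ?_
    apply Continuous.continuousOn
    unfold Function.uncurry
    fun_prop
  rw [integral_sub] at h1
  · rw [sub_eq_iff_eq_add] at h1
    rw [h1]
    simp_rw [nq_ibp he]
    rw [intervalIntegral.integral_neg]
    simp
    ring
  · refine IntegrableOn.mono_set ?_ Metric.ball_subset_closedBall
    refine ContinuousOn.integrableOn_compact (isCompact_closedBall _ _) ?_
    apply Continuous.continuousOn
    fun_prop
  · exact integrableOn_const measure_ball_lt_top.ne

lemma nqDel_nonneg {N : ℕ} (e : ℝ) (z : Euc N) : 0 ≤ nqDel N e z := by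
  unfold nqDel; positivity

lemma nqDel_mass {N : ℕ} (hN : 3 ≤ N) : Integrable (nqDel N 1) ∧
    ∫ z, nqDel N 1 z = N * volume.real (Metric.ball (0 : Euc N) 1) := by
  have hN0 : (3:ℝ) ≤ N := by exact_mod_cast hN
  have : Nonempty (Fin N) := ⟨⟨0, by omega⟩⟩
  set g : ℝ → ℝ := fun r => N * (1:ℝ) ^ 2 * (r ^ 2 + 1 ^ 2) ^ (-((N : ℝ) / 2) - 1)
  have hfg : nqDel N 1 = fun z => g ‖z‖ := by ext z; simp [nqDel, g]
  set G : ℝ → ℝ := fun r => (r / √(1 + r ^ 2)) ^ N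
  have hder : ∀ r ∈ Ici (0:ℝ), HasDerivAt G (r ^ (N - 1) • g r) r := by
    intro r _
    have hp : 0 < 1 + r ^ 2 := by positivity
    have hs : 0 < √(1 + r ^ 2) := Real.sqrt_pos.2 hp
    have hsq : √(1 + r ^ 2) ^ 2 = 1 + r ^ 2 := Real.sq_sqrt hp.le
    have h1 : HasDerivAt (fun r : ℝ => 1 + r ^ 2) (2 * r) r := by
      simpa using (hasDerivAt_pow 2 r).const_add 1
    have h2 := ((hasDerivAt_id r).div (h1.sqrt hp.ne') hs.ne').pow N
    convert! h2 using 1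
    have e1 : (r ^ 2 + 1 ^ 2) ^ (-((N : ℝ) / 2) - 1) = (√(1 + r ^ 2) ^ (N + 2))⁻¹ := by
      rw [Real.sqrt_eq_rpow, ← Real.rpow_natCast _ (N + 2), ← Real.rpow_mul hp.le, ← Real.rpow_neg hp.le]
      push_cast
      congr 1 <;> ring
    simp only [g, smul_eq_mul, id]
    rw [e1]
    obtain ⟨k, rfl⟩ : ∃ k, N = k + 1 := ⟨N - 1, by omega⟩
    simp only [Nat.add_sub_cancel]
    set s := √(1 + r ^ 2)
    have : (1 * s - r * (2 * r / (2 * s))) / s ^ 2 = 1 / s ^ 3 := by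
      field_simp
      linarith
    simp only [Pi.div_apply, id, div_pow]
    rw [this]
    change _ = ((k + 1 : ℕ) : ℝ) * (r ^ k / s ^ k) * (1 / s ^ 3)
    field_simp
    ring
  have hlim : Tendsto G atTop (nhds 1) := by
    have h1 : Tendsto (fun r : ℝ => r / √(1 + r ^ 2)) atTop (nhds 1) := by
      have h2 : Tendsto (fun r : ℝ => 1 / √(r⁻¹ ^ 2 + 1)) atTop (nhds (1 / √(0 ^ 2 + 1))) := by
        apply Tendsto.div tendsto_const_nhds _ (by simp)
        exact (((tendsto_inv_atTop_zero.pow 2).add_const 1).sqrt)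
      simp only [ne_eq, OfNat.ofNat_ne_zero, not_false_eq_true, zero_pow, zero_add, sqrt_one, div_one] at h2
      refine h2.congr' ?_
      filter_upwards [eventually_gt_atTop 0] with r hr
      rw [show 1 + r ^ 2 = r ^ 2 * (r⁻¹ ^ 2 + 1) by field_simp, Real.sqrt_mul (by positivity),
        Real.sqrt_sq hr.le]
      field_simp
    simpa using h1.pow N
  have hint : IntegrableOn (fun r => r ^ (N - 1) • g r) (Ioi 0) :=
    integrableOn_Ioi_deriv_of_nonneg' hder (fun r hr => by
      have : (0:ℝ) < r := hr
      simp only [g, smul_eq_mul]; positivity) hlim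
  have hdim : Module.finrank ℝ (Euc N) = N := by simp
  constructor
  · rw [hfg, integrable_fun_norm_addHaar volume (f := g), hdim]
    exact hint
  · rw [hfg, integral_fun_norm_addHaar volume g, hdim, integral_Ioi_of_hasDerivAt_of_tendsto' hder hint hlim]
    simp [G, show N ≠ 0 by omega]


lemma nqDel_scale {N : ℕ} {e : ℝ} (he : 0 < e) (z : Euc N) :
    nqDel N e (e • z) = (e ^ N)⁻¹ * nqDel N 1 z := by
  unfold nqDel
  rw [norm_smul, Real.norm_eq_abs, abs_of_pos he,
    show (e * ‖z‖) ^ 2 + e ^ 2 = e ^ 2 * (‖z‖ ^ 2 + 1 ^ 2) by ring,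
    Real.mul_rpow (by positivity) (by positivity)]
  have : (e ^ 2) ^ (-((N : ℝ) / 2) - 1) = (e ^ N)⁻¹ * (e ^ 2)⁻¹ := by
    rw [Real.rpow_sub (by positivity), Real.rpow_one, Real.rpow_neg (by positivity),
      ← Real.rpow_natCast e 2, ← Real.rpow_mul he.le, ← Real.rpow_natCast e N]
    push_cast
    rw [show (2 : ℝ) * (N / 2) = N by ring]
    rfl
  rw [this]
  field_simp

lemma nq_subst {N : ℕ} {e r : ℝ} (he : 0 < e) (hr : 0 < r) (x : Euc N) :
    ∫ y, nqPhi N y * nqDel N e (x - r • y) =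
      (r ^ N)⁻¹ * ∫ z, nqPhi N (r⁻¹ • (x - e • z)) * nqDel N 1 z := by
  set G : Euc N → ℝ := fun y => nqPhi N y * nqDel N e (x - r • y)
  have h1 : ∫ z, G (r⁻¹ • x - (r⁻¹ * e) • z) = |((r⁻¹ * e) ^ N)⁻¹| * ∫ y, G y := by
    have := Measure.integral_comp_smul volume (fun w => G (r⁻¹ • x - w)) (r⁻¹ * e)
    rw [this, integral_sub_left_eq_self]
    simp
  have h2 : ∀ z, G (r⁻¹ • x - (r⁻¹ * e) • z) =
      (e ^ N)⁻¹ * (nqPhi N (r⁻¹ • (x - e • z)) * nqDel N 1 z) := by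
    intro z
    have e1 : r⁻¹ • x - (r⁻¹ * e) • z = r⁻¹ • (x - e • z) := by rw [smul_sub, smul_smul]
    have e2 : x - r • (r⁻¹ • (x - e • z)) = e • z := by
      rw [smul_smul, mul_inv_cancel₀ hr.ne', one_smul]; abel
    simp only [G]
    rw [e1, e2, nqDel_scale he]
    ring
  simp_rw [h2] at h1
  rw [integral_const_mul, abs_of_pos (by positivity), mul_pow, mul_inv] at h1
  have hp : (e ^ N)⁻¹ ≠ 0 := by positivity
  have : ∫ z, nqPhi N (r⁻¹ • (x - e • z)) * nqDel N 1 z = r ^ N * ∫ y, G y := by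
    apply mul_left_cancel₀ hp
    rw [h1]
    simp
    ring
  rw [this]
  field_simp

lemma nq_limit {N : ℕ} (hN : 3 ≤ N) {x : Euc N} (hx : x ≠ 0) (e : ℕ → ℝ) (he : ∀ n, 0 < e n)
    (he1 : ∀ n, e n ≤ 1) (hlim : Tendsto e atTop (nhds 0)) :
    Tendsto (fun n => ∫ r in (0:ℝ)..1, r * ∫ y, nqPhi N y * nqDel N (e n) (x - r • y)) atTop
      (nhds (∫ r in (0:ℝ)..1, r * ((r ^ N)⁻¹ *
        (nqPhi N (r⁻¹ • x) * (N * volume.real (Metric.ball (0 : Euc N) 1)))))) := by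
  obtain ⟨hint, hmass⟩ := nqDel_mass hN
  have hP := (nqPhi_lip N).continuous
  have hN0 : (3:ℝ) ≤ N := by exact_mod_cast hN
  set m := ∫ z, nqDel N 1 z with hm
  have hm0 : 0 ≤ m := integral_nonneg (nqDel_nonneg 1)
  have hs : 0 < ‖x‖ := norm_pos_iff.2 hx
  set C1 : ℝ := N * 1 ^ 2 * ((‖x‖ / 2) ^ 2) ^ (-((N : ℝ) / 2) - 1) with hC1
  have hC1p : 0 ≤ C1 := by positivity
  set I0 := ∫ y, nqPhi N y with hI0
  have hI0p : 0 ≤ I0 := integral_nonneg nqPhi_nonneg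
  refine intervalIntegral.tendsto_integral_filter_of_dominated_convergence
    (fun _ => C1 * I0 + ((‖x‖ / 2) ^ N)⁻¹ * m) ?_ ?_ ?_ ?_
  · refine Eventually.of_forall fun n => ?_
    apply StronglyMeasurable.aestronglyMeasurable
    have hD := nqDel_cont (N := N) (he n)
    refine stronglyMeasurable_id.mul (StronglyMeasurable.integral_prod_right'
      (f := fun p : ℝ × Euc N => nqPhi N p.2 * nqDel N (e n) (x - p.1 • p.2)) ?_)
    apply Continuous.stronglyMeasurable
    fun_prop
  · refine Eventually.of_forall fun n => Eventually.of_forall fun r hr => ?_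
    rw [uIoc_of_le zero_le_one] at hr
    obtain ⟨hr0, hr1⟩ := hr
    have hnn : 0 ≤ ∫ y, nqPhi N y * nqDel N (e n) (x - r • y) :=
      integral_nonneg fun y => mul_nonneg (nqPhi_nonneg _) (nqDel_nonneg _ _)
    rw [Real.norm_eq_abs, abs_of_nonneg (by positivity)]
    rcases le_or_gt r (‖x‖ / 2) with h | h
    · have h1 : ∫ y, nqPhi N y * nqDel N (e n) (x - r • y) ≤ C1 * I0 := by
        rw [hI0, ← integral_const_mul]
        refine integral_mono_of_nonneg (Eventually.of_forall fun y => mul_nonneg (nqPhi_nonneg _) (nqDel_nonneg _ _))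
          ((nqPhi_int N).const_mul _) (Eventually.of_forall fun y => ?_)
        simp only
        rcases le_or_gt 1 ‖y‖ with hy | hy
        · simp [nqPhi_zero hy]
        rw [mul_comm]
        refine mul_le_mul_of_nonneg_right ?_ (nqPhi_nonneg _)
        have h3 : ‖x‖ / 2 ≤ ‖x - r • y‖ := by
          have := norm_sub_norm_le x (r • y)
          rw [norm_smul, Real.norm_eq_abs, abs_of_pos hr0] at this
          nlinarith
        unfold nqDel
        rw [hC1]
        have h4 : (‖x - r • y‖ ^ 2 + e n ^ 2) ^ (-((N : ℝ) / 2) - 1) ≤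
            ((‖x‖ / 2) ^ 2) ^ (-((N : ℝ) / 2) - 1) := by
          apply Real.rpow_le_rpow_of_nonpos (by positivity) _ (by linarith)
          have : (‖x‖ / 2) ^ 2 ≤ ‖x - r • y‖ ^ 2 := by gcongr
          nlinarith [sq_nonneg (e n)]
        have := he1 n
        have := he n
        gcongr
      have : 0 ≤ ((‖x‖ / 2) ^ N)⁻¹ * m := by positivity
      nlinarith
    · rw [nq_subst (he n) hr0]
      have h1 : ∫ z, nqPhi N (r⁻¹ • (x - e n • z)) * nqDel N 1 z ≤ m := by
        refine integral_mono_of_nonneg (Eventually.of_forall fun y => mul_nonneg (nqPhi_nonneg _) (nqDel_nonneg _ _))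
          hint (Eventually.of_forall fun y => ?_)
        have := nqPhi_le (r⁻¹ • (x - e n • y))
        have := nqDel_nonneg (N := N) 1 y
        simp only
        nlinarith
      have h0 : 0 ≤ ∫ z, nqPhi N (r⁻¹ • (x - e n • z)) * nqDel N 1 z :=
        integral_nonneg fun y => mul_nonneg (nqPhi_nonneg _) (nqDel_nonneg _ _)
      have h2 : (r ^ N)⁻¹ ≤ ((‖x‖ / 2) ^ N)⁻¹ := by gcongr
      have h3 : (r ^ N)⁻¹ * ∫ z, nqPhi N (r⁻¹ • (x - e n • z)) * nqDel N 1 z ≤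
        ((‖x‖ / 2) ^ N)⁻¹ * m := by gcongr
      have h4 : 0 ≤ (r ^ N)⁻¹ * ∫ z, nqPhi N (r⁻¹ • (x - e n • z)) * nqDel N 1 z := by positivity
      have : 0 ≤ C1 * I0 := by positivity
      nlinarith
  · simp
  · refine Eventually.of_forall fun r hr => ?_
    rw [uIoc_of_le zero_le_one] at hr
    obtain ⟨hr0, hr1⟩ := hr
    simp_rw [fun n => nq_subst (he n) hr0 x]
    refine Filter.Tendsto.const_mul _ (Filter.Tendsto.const_mul _ ?_)
    rw [← hmass, hm, ← integral_const_mul]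
    refine tendsto_integral_of_dominated_convergence (nqDel N 1) ?_ hint ?_ ?_
    · intro n
      have hD := nqDel_cont (N := N) one_pos
      apply Continuous.aestronglyMeasurable
      fun_prop
    · intro n
      refine Eventually.of_forall fun y => ?_
      have := nqPhi_le (r⁻¹ • (x - e n • y))
      have := nqPhi_nonneg (r⁻¹ • (x - e n • y))
      have := nqDel_nonneg (N := N) 1 y
      rw [Real.norm_eq_abs, abs_of_nonneg (by positivity)]
      nlinarith
    · refine Eventually.of_forall fun y => ?_
      refine Filter.Tendsto.mul_const _ ?_
      have : Tendsto (fun n => r⁻¹ • (x - e n • y)) atTop (nhds (r⁻¹ • (x - (0:ℝ) • y))) :=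
        (tendsto_const_nhds.sub (hlim.smul_const y)).const_smul _
      simp only [zero_smul, sub_zero] at this
      exact (hP.tendsto _).comp this

noncomputable def nqV (N : ℕ) (s : ℝ) : ℝ :=
  if s < 1 then (N : ℝ) / (2 * (N - 2)) - s ^ 2 / 2 else s ^ ((2:ℝ) - N) / (N - 2)

lemma nq_J {N : ℕ} (hN : 3 ≤ N) {x : Euc N} (hx : x ≠ 0) (w : ℝ) :
    ∫ r in (0:ℝ)..1, r * ((r ^ N)⁻¹ * (nqPhi N (r⁻¹ • x) * (N * w))) =
      w * (‖x‖ ^ ((2:ℝ) - N) / (N - 2) - nqV N ‖x‖) := by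
  have hN0 : (3:ℝ) ≤ N := by exact_mod_cast hN
  have hs : 0 < ‖x‖ := norm_pos_iff.2 hx
  set s := ‖x‖ with hsdef
  have hnorm : ∀ r : ℝ, 0 < r → ‖r⁻¹ • x‖ = s / r := by
    intro r hr
    rw [norm_smul, norm_inv, Real.norm_eq_abs, abs_of_pos hr, ← hsdef]
    field_simp
  have hz : ∀ r : ℝ, 0 < r → r ≤ s → r * ((r ^ N)⁻¹ * (nqPhi N (r⁻¹ • x) * (N * w))) = 0 := by
    intro r hr hrs
    rw [nqPhi_zero]
    · simp
    · rw [hnorm r hr, le_div_iff₀ hr]; linarith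
  unfold nqV
  split_ifs with h
  · have hI1 : ∫ r in (0:ℝ)..s, r * ((r ^ N)⁻¹ * (nqPhi N (r⁻¹ • x) * (N * w))) = 0 := by
      rw [intervalIntegral.integral_of_le hs.le, setIntegral_congr_fun measurableSet_Ioc
        (fun r hr => hz r hr.1 hr.2)]
      simp
    set F : ℝ → ℝ := fun r => N * w * ((-(r ^ ((2:ℝ) - N)) / (N - 2) + s ^ 2 * r ^ (-(N:ℝ)) / N) / 2)
    have hder : ∀ r ∈ uIcc s 1, HasDerivAt F (r * ((r ^ N)⁻¹ * (nqPhi N (r⁻¹ • x) * (N * w)))) r := by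
      intro r hr
      rw [uIcc_of_le h.le] at hr
      have hr0 : 0 < r := hs.trans_le hr.1
      have d1 : HasDerivAt (fun r : ℝ => r ^ ((2:ℝ) - N)) (((2:ℝ) - N) * r ^ ((2:ℝ) - N - 1)) r :=
        hasDerivAt_rpow_const (Or.inl hr0.ne')
      have d2 : HasDerivAt (fun r : ℝ => r ^ (-(N:ℝ))) ((-(N:ℝ)) * r ^ (-(N:ℝ) - 1)) r :=
        hasDerivAt_rpow_const (Or.inl hr0.ne')
      have d3 := (((d1.neg.div_const ((N:ℝ) - 2)).add ((d2.const_mul (s ^ 2)).div_const (N:ℝ))).div_const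
        2).const_mul (N * w)
      convert! d3 using 1
      rw [nqPhi_in (by rw [hnorm r hr0, div_le_one hr0]; exact hr.1), hnorm r hr0,
        show (2:ℝ) - N - 1 = 1 + -N by ring, Real.rpow_add hr0, Real.rpow_sub hr0, Real.rpow_one,
        Real.rpow_neg hr0.le, Real.rpow_natCast]
      have : (N:ℝ) - 2 ≠ 0 := by linarith
      field_simp
      ring
    have hii : ∀ a b : ℝ, 0 < a → 0 < b → IntervalIntegrable
        (fun r => r * ((r ^ N)⁻¹ * (nqPhi N (r⁻¹ • x) * (N * w)))) volume a b := by
      intro a b ha hb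
      apply ContinuousOn.intervalIntegrable
      have hP := (nqPhi_lip N).continuous
      have hne : ∀ r ∈ uIcc a b, r ≠ 0 := fun r hr =>
        ((lt_min ha hb).trans_le hr.1).ne'
      have hi : ContinuousOn (fun r : ℝ => r⁻¹) (uIcc a b) := continuousOn_inv₀.mono fun r hr => hne r hr
      refine continuousOn_id.mul (ContinuousOn.mul ?_ (ContinuousOn.mul ?_ continuousOn_const))
      · exact ContinuousOn.inv₀ (by fun_prop) fun r hr => pow_ne_zero _ (hne r hr)
      · exact hP.comp_continuousOn (hi.smul continuousOn_const)
    have hi0 : IntervalIntegrable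
        (fun r => r * ((r ^ N)⁻¹ * (nqPhi N (r⁻¹ • x) * (N * w)))) volume 0 s := by
      rw [intervalIntegrable_iff_integrableOn_Ioc_of_le hs.le]
      exact (integrableOn_congr_fun (fun r hr => hz r hr.1 hr.2) measurableSet_Ioc).2 integrableOn_zero
    rw [← intervalIntegral.integral_add_adjacent_intervals hi0 (hii s 1 hs one_pos), hI1,
      intervalIntegral.integral_eq_sub_of_hasDerivAt hder (hii s 1 hs one_pos)]
    simp only [F, Real.one_rpow]
    have e1 : s ^ 2 * s ^ (-(N:ℝ)) = s ^ ((2:ℝ) - N) := by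
      rw [sub_eq_add_neg, Real.rpow_add hs]; norm_num
    rw [e1]
    have : (N:ℝ) - 2 ≠ 0 := by linarith
    field_simp
    ring
  · rw [intervalIntegral.integral_of_le zero_le_one, setIntegral_congr_fun measurableSet_Ioc
        (fun r hr => hz r hr.1 (hr.2.trans (not_lt.1 h)))]
    simp

noncomputable def nqK (N : ℕ) (z : Euc N) : ℝ≥0∞ :=
  (ENNReal.ofReal ‖z‖) ^ ((2 : ℝ) - (N : ℝ)) / ENNReal.ofReal ((N : ℝ) - 2)

lemma nqK_meas (N : ℕ) : Measurable (nqK N) := by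
  unfold nqK
  fun_prop

lemma nqK_ofReal {N : ℕ} (hN : 3 ≤ N) {z : Euc N} (hz : z ≠ 0) :
    nqK N z = ENNReal.ofReal (‖z‖ ^ ((2:ℝ) - N) / (N - 2)) := by
  have hN0 : (3:ℝ) ≤ N := by exact_mod_cast hN
  unfold nqK
  rw [ENNReal.ofReal_rpow_of_pos (norm_pos_iff.2 hz), ENNReal.ofReal_div_of_pos (by linarith)]

lemma nqH_tendsto {N : ℕ} {z : Euc N} (hz : z ≠ 0) (e : ℕ → ℝ)
    (hlim : Tendsto e atTop (nhds 0)) :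
    Tendsto (fun n => nqH N (e n) z) atTop (nhds (‖z‖ ^ ((2:ℝ) - N) / (N - 2))) := by
  have hs := norm_pos_iff.2 hz
  unfold nqH
  refine Filter.Tendsto.div_const ?_ _
  have h1 : Tendsto (fun n => ‖z‖ ^ 2 + e n ^ 2) atTop (nhds (‖z‖ ^ 2 + 0 ^ 2)) :=
    tendsto_const_nhds.add (hlim.pow 2)
  have h2 := h1.rpow_const (p := 1 - (N:ℝ) / 2) (Or.inl (by positivity))
  convert! h2 using 2
  rw [zero_pow two_ne_zero, add_zero, ← Real.rpow_natCast, ← Real.rpow_mul hs.le]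
  congr 1
  push_cast
  ring

lemma nq_ball_potential {N : ℕ} (hN : 3 ≤ N) {x : Euc N} (hx : x ≠ 0) :
    ∫⁻ y in Metric.ball (0 : Euc N) 1, nqK N (x - y) =
      ENNReal.ofReal (volume.real (Metric.ball (0 : Euc N) 1) * nqV N ‖x‖) := by
  have hN0 : (3:ℝ) ≤ N := by exact_mod_cast hN
  have : Nonempty (Fin N) := ⟨⟨0, by omega⟩⟩
  set w := volume.real (Metric.ball (0 : Euc N) 1)
  set e : ℕ → ℝ := fun n => 1 / ((n:ℝ) + 1) with he
  have hep : ∀ n, 0 < e n := fun n => by simp only [he]; positivity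
  have hel : Tendsto e atTop (nhds 0) := tendsto_one_div_add_atTop_nhds_zero_nat
  have hanti : ∀ i j, i ≤ j → e j ≤ e i := fun i j hij => by simp only [he]; gcongr
  have he1 : ∀ n, e n ≤ 1 := fun n => by simpa [he] using hanti 0 n (Nat.zero_le n)
  have hHnn : ∀ n z, 0 ≤ nqH N (e n) z := fun n z => by
    unfold nqH
    exact div_nonneg (Real.rpow_nonneg (by positivity) _) (by linarith)
  have t1 : Tendsto (fun n => ∫⁻ y in Metric.ball (0 : Euc N) 1, ENNReal.ofReal (nqH N (e n) (x - y))) atTop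
      (nhds (∫⁻ y in Metric.ball (0 : Euc N) 1, nqK N (x - y))) := by
    refine lintegral_tendsto_of_tendsto_of_monotone ?_ ?_ ?_
    · intro n
      have := nqH_cont (N := N) (hep n)
      apply Measurable.aemeasurable
      apply Measurable.ennreal_ofReal
      apply Continuous.measurable
      fun_prop
    · refine Eventually.of_forall fun y i j hij => ENNReal.ofReal_le_ofReal ?_
      unfold nqH
      have h1 := hanti i j hij
      have h2 := hep j
      have h3 : (‖x - y‖ ^ 2 + e i ^ 2) ^ (1 - (N : ℝ) / 2) ≤ (‖x - y‖ ^ 2 + e j ^ 2) ^ (1 - (N : ℝ) / 2) :=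
        Real.rpow_le_rpow_of_nonpos (by positivity) (by gcongr) (by linarith)
      exact div_le_div_of_nonneg_right h3 (by linarith)
    · apply ae_restrict_of_ae
      have : ∀ᵐ y : Euc N, y ≠ x := by simp [ae_iff]
      filter_upwards [this] with y hy
      have hz : x - y ≠ 0 := sub_ne_zero.2 (Ne.symm hy)
      rw [nqK_ofReal hN hz]
      exact ENNReal.tendsto_ofReal (nqH_tendsto hz e hel)
  have t2 : ∀ n, ∫⁻ y in Metric.ball (0 : Euc N) 1, ENNReal.ofReal (nqH N (e n) (x - y)) =
      ENNReal.ofReal (∫ y in Metric.ball (0 : Euc N) 1, nqH N (e n) (x - y)) := by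
    intro n
    rw [ofReal_integral_eq_lintegral_ofReal]
    · refine IntegrableOn.mono_set ?_ Metric.ball_subset_closedBall
      refine ContinuousOn.integrableOn_compact (isCompact_closedBall _ _) ?_
      apply Continuous.continuousOn
      have := nqH_cont (N := N) (hep n)
      fun_prop
    · exact Eventually.of_forall fun y => hHnn n _
  have t3 : Tendsto (fun n => ∫ y in Metric.ball (0 : Euc N) 1, nqH N (e n) (x - y)) atTop
      (nhds (w * nqV N ‖x‖)) := by
    simp_rw [fun n => nq_identity hN (hep n) x]
    have := ((nqH_tendsto hx e hel).const_mul w).sub (nq_limit hN hx e hep he1 hel)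
    rw [nq_J hN hx] at this
    convert! this using 2
    ring
  refine tendsto_nhds_unique t1 ?_
  simp_rw [t2]
  exact ENNReal.tendsto_ofReal t3


noncomputable def nqC (N : ℕ) : ℝ≥0∞ := ENNReal.ofReal (1 / (((N:ℝ) - 2) * Real.Gamma ((N:ℝ) / 2 - 1)))

lemma nqK_gamma {N : ℕ} (hN : 3 ≤ N) (z : Euc N) :
    nqK N z = nqC N * ∫⁻ t in Ioi (0:ℝ), ENNReal.ofReal (t ^ ((N:ℝ) / 2 - 1 - 1) * rexp (-(‖z‖ ^ 2 * t))) := by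
  have hN0 : (3:ℝ) ≤ N := by exact_mod_cast hN
  have ha : 0 < (N:ℝ) / 2 - 1 := by linarith
  have hG := Real.Gamma_pos_of_pos ha
  have hN2 : 0 < (N:ℝ) - 2 := by linarith
  have hC : 0 < 1 / (((N:ℝ) - 2) * Real.Gamma ((N:ℝ) / 2 - 1)) := by positivity
  by_cases hz : z = 0
  · have h1 : ∫⁻ t in Ioi (0:ℝ), ENNReal.ofReal (t ^ ((N:ℝ) / 2 - 1 - 1) * rexp (-(‖z‖ ^ 2 * t))) = ⊤ := by
      by_contra h
      apply not_integrableOn_Ioi_rpow ((N:ℝ) / 2 - 1 - 1)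
      refine ⟨by fun_prop, ?_⟩
      rw [hasFiniteIntegral_iff_ofReal]
      · subst hz
        simpa using lt_top_iff_ne_top.2 h
      · filter_upwards [ae_restrict_mem measurableSet_Ioi] with t ht
        exact Real.rpow_nonneg (le_of_lt ht) _
    rw [h1, ENNReal.mul_top]
    · subst hz
      unfold nqK
      simp only [norm_zero, ENNReal.ofReal_zero]
      rw [ENNReal.zero_rpow_of_neg (by linarith), ENNReal.top_div_of_ne_top ENNReal.ofReal_ne_top]
    · unfold nqC
      simpa using hC
  · have hs := norm_pos_iff.2 hz
    have hr : 0 < ‖z‖ ^ 2 := by positivity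
    have h1 := integral_rpow_mul_exp_neg_mul_Ioi ha hr
    have hint : Integrable (fun t : ℝ => t ^ ((N:ℝ) / 2 - 1 - 1) * rexp (-(‖z‖ ^ 2 * t)))
        (volume.restrict (Ioi 0)) := by
      by_contra h
      rw [integral_undef h] at h1
      have : 0 < (1 / ‖z‖ ^ 2) ^ ((N:ℝ) / 2 - 1) * Real.Gamma ((N:ℝ) / 2 - 1) := by positivity
      linarith
    rw [← ofReal_integral_eq_lintegral_ofReal hint, h1, nqC, ← ENNReal.ofReal_mul hC.le, nqK_ofReal hN hz]
    · congr 1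
      have : (1 / ‖z‖ ^ 2) ^ ((N:ℝ) / 2 - 1) = ‖z‖ ^ ((2:ℝ) - N) := by
        rw [one_div, Real.inv_rpow (by positivity), ← Real.rpow_natCast, ← Real.rpow_mul hs.le,
          ← Real.rpow_neg hs.le]
        congr 1
        push_cast
        ring
      rw [this]
      field_simp
    · filter_upwards [ae_restrict_mem measurableSet_Ioi] with t ht
      exact mul_nonneg (Real.rpow_nonneg (le_of_lt ht) _) (Real.exp_pos _).le

noncomputable def nqg (N : ℕ) (t : ℝ) (a z : Euc N) : ℝ≥0∞ :=
  ENNReal.ofReal (rexp (-(2 * t) * ‖z - a‖ ^ 2))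

lemma nqg_meas (N : ℕ) : Measurable (fun p : (ℝ × Euc N) × Euc N => nqg N p.1.1 p.2 p.1.2) := by
  unfold nqg
  fun_prop

lemma nq_gauss_int {N : ℕ} {b : ℝ} (hb : 0 < b) :
    Integrable (fun v : Euc N => rexp (-b * ‖v‖ ^ 2)) ∧
    ∫ v : Euc N, rexp (-b * ‖v‖ ^ 2) = (π / b) ^ ((N:ℝ) / 2) := by
  have h1 := GaussianFourier.integral_rexp_neg_mul_sq_norm (V := Euc N) hb
  rw [finrank_euclideanSpace_fin] at h1
  refine ⟨?_, h1⟩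
  by_contra h
  rw [integral_undef h] at h1
  have : 0 < (π / b) ^ ((N:ℝ) / 2) := by positivity
  linarith

lemma nqg_conv {N : ℕ} {t : ℝ} (ht : 0 < t) (x y : Euc N) :
    ENNReal.ofReal (rexp (-(‖x - y‖ ^ 2 * t))) =
      ENNReal.ofReal ((4 * t / π) ^ ((N:ℝ) / 2)) * ∫⁻ z, nqg N t x z * nqg N t y z := by
  have hb : 0 < 4 * t := by linarith
  obtain ⟨hi, hv⟩ := nq_gauss_int (N := N) hb
  have h1 : ∀ z, nqg N t x z * nqg N t y z = ENNReal.ofReal (rexp (-(‖x - y‖ ^ 2 * t))) *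
      ENNReal.ofReal (rexp (-(4 * t) * ‖z - (2:ℝ)⁻¹ • (x + y)‖ ^ 2)) := by
    intro z
    unfold nqg
    rw [← ENNReal.ofReal_mul (Real.exp_pos _).le, ← ENNReal.ofReal_mul (Real.exp_pos _).le,
      ← Real.exp_add, ← Real.exp_add]
    congr 2
    have p := parallelogram_law_with_norm ℝ (z - x) (z - y)
    have e1 : z - x + (z - y) = (2:ℝ) • (z - (2:ℝ)⁻¹ • (x + y)) := by
      rw [smul_sub, smul_smul]; norm_num; rw [two_smul]; abel
    have e2 : z - x - (z - y) = y - x := by abel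
    rw [e1, e2, norm_smul, norm_sub_rev y x, Real.norm_eq_abs, abs_of_pos (by norm_num : (0:ℝ) < 2)] at p
    nlinarith
  simp_rw [h1]
  rw [lintegral_const_mul _ (by fun_prop), lintegral_sub_right_eq_self
    (fun z => ENNReal.ofReal (rexp (-(4 * t) * ‖z‖ ^ 2))), ← ofReal_integral_eq_lintegral_ofReal hi
    (Eventually.of_forall fun _ => (Real.exp_pos _).le), hv, mul_left_comm, ← ENNReal.ofReal_mul (by positivity),
    ← Real.mul_rpow (by positivity) (by positivity)]
  rw [show 4 * t / π * (π / (4 * t)) = 1 by field_simp]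
  simp

noncomputable def nqw (N : ℕ) (t : ℝ) : ℝ≥0∞ :=
  nqC N * ENNReal.ofReal (t ^ ((N:ℝ) / 2 - 1 - 1)) * ENNReal.ofReal ((4 * t / π) ^ ((N:ℝ) / 2))

lemma nqw_meas (N : ℕ) : Measurable (nqw N) := by unfold nqw; fun_prop

lemma nqw_pos {N : ℕ} (hN : 3 ≤ N) {t : ℝ} (ht : 0 < t) : nqw N t ≠ 0 ∧ nqw N t ≠ ⊤ := by
  have hN0 : (3:ℝ) ≤ N := by exact_mod_cast hN
  have ha : 0 < (N:ℝ) / 2 - 1 := by linarith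
  have hG := Real.Gamma_pos_of_pos ha
  have hN2 : 0 < (N:ℝ) - 2 := by linarith
  have hC : 0 < 1 / (((N:ℝ) - 2) * Real.Gamma ((N:ℝ) / 2 - 1)) := by positivity
  have h1 : 0 < t ^ ((N:ℝ) / 2 - 1 - 1) := by positivity
  have h2 : 0 < (4 * t / π) ^ ((N:ℝ) / 2) := by positivity
  unfold nqw nqC
  rw [← ENNReal.ofReal_mul hC.le, ← ENNReal.ofReal_mul (by positivity)]
  refine ⟨?_, ENNReal.ofReal_ne_top⟩
  rw [ne_eq, ENNReal.ofReal_eq_zero, not_le]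
  positivity

noncomputable def nqnu (N : ℕ) : Measure (ℝ × Euc N) := (volume.restrict (Ioi (0:ℝ))).prod volume

instance (N : ℕ) : SFinite (nqnu N) := by unfold nqnu; infer_instance

lemma nqK_rep {N : ℕ} (hN : 3 ≤ N) (x y : Euc N) :
    nqK N (x - y) = ∫⁻ p, nqw N p.1 * (nqg N p.1 x p.2 * nqg N p.1 y p.2) ∂(nqnu N) := by
  have hm : ∀ a : Euc N, Measurable (fun p : ℝ × Euc N => nqg N p.1 a p.2) := fun a => by
    unfold nqg; fun_prop
  have hw : Measurable (fun p : ℝ × Euc N => nqw N p.1) := (nqw_meas N).comp measurable_fst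
  have hmeas : Measurable (fun p : ℝ × Euc N =>
      nqw N p.1 * (nqg N p.1 x p.2 * nqg N p.1 y p.2)) := hw.mul ((hm x).mul (hm y))
  rw [nqnu, lintegral_prod _ hmeas.aemeasurable, nqK_gamma hN,
    ← lintegral_const_mul _ (by fun_prop)]
  refine setLIntegral_congr_fun measurableSet_Ioi fun t ht => ?_
  have ht : 0 < t := ht
  simp only
  rw [lintegral_const_mul, ENNReal.ofReal_mul (by positivity), nqg_conv ht, nqw]
  · ring
  · unfold nqg; fun_prop

noncomputable def nqG (N : ℕ) (α : Measure (Euc N)) (p : ℝ × Euc N) : ℝ≥0∞ :=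
  ∫⁻ x, nqg N p.1 x p.2 ∂α

lemma nqG_meas (N : ℕ) (α : Measure (Euc N)) [SFinite α] : Measurable (nqG N α) := by
  unfold nqG
  exact (nqg_meas N).lintegral_prod_right'

noncomputable def nqI (N : ℕ) (α β : Measure (Euc N)) : ℝ≥0∞ := ∫⁻ x, ∫⁻ y, nqK N (x - y) ∂β ∂α

lemma nqI_rep {N : ℕ} (hN : 3 ≤ N) (α β : Measure (Euc N)) [SFinite α] [SFinite β] :
    nqI N α β = ∫⁻ p, nqw N p.1 * (nqG N α p * nqG N β p) ∂(nqnu N) := by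
  have hw : Measurable (fun p : ℝ × Euc N => nqw N p.1) := (nqw_meas N).comp measurable_fst
  have hm := nqg_meas N
  have hm' : ∀ a : Euc N, Measurable (fun p : ℝ × Euc N => nqg N p.1 a p.2) := fun a => by
    unfold nqg; fun_prop
  unfold nqI
  simp_rw [nqK_rep hN]
  have h1 : ∀ x, ∫⁻ y, ∫⁻ p, nqw N p.1 * (nqg N p.1 x p.2 * nqg N p.1 y p.2) ∂(nqnu N) ∂β =
      ∫⁻ p, nqw N p.1 * nqG N β p * nqg N p.1 x p.2 ∂(nqnu N) := by
    intro x
    rw [lintegral_lintegral_swap]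
    · refine lintegral_congr fun p => ?_
      have : Measurable (fun y => nqg N p.1 y p.2) := by unfold nqg; fun_prop
      simp_rw [← mul_assoc]
      rw [lintegral_const_mul _ this]
      simp only [nqG]
      ring
    · apply Measurable.aemeasurable
      unfold Function.uncurry
      refine (hw.comp measurable_snd).mul (((hm' x).comp measurable_snd).mul ?_)
      exact hm.comp measurable_swap
  simp_rw [h1]
  rw [lintegral_lintegral_swap]
  · refine lintegral_congr fun p => ?_
    have : Measurable (fun y => nqg N p.1 y p.2) := by unfold nqg; fun_prop
    rw [lintegral_const_mul _ this]
    simp only [nqG]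
    ring
  · apply Measurable.aemeasurable
    unfold Function.uncurry
    exact (((hw.mul (nqG_meas N β)).comp measurable_snd).mul (hm.comp measurable_swap))

lemma nqG_le {N : ℕ} (α : Measure (Euc N)) [IsProbabilityMeasure α] {p : ℝ × Euc N} (hp : 0 < p.1) :
    nqG N α p ≤ 1 := by
  unfold nqG
  calc _ ≤ ∫⁻ x, 1 ∂α := by
        refine lintegral_mono fun x => ?_
        unfold nqg
        rw [ENNReal.ofReal_le_one, Real.exp_le_one_iff]
        have := mul_nonneg hp.le (sq_nonneg ‖p.2 - x‖)
        nlinarith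
    _ = 1 := by simp

lemma nq_amgm {a b : ℝ≥0∞} (ha : a ≠ ⊤) (hb : b ≠ ⊤) :
    2 * (a * b) ≤ a * a + b * b ∧ (2 * (a * b) = a * a + b * b → a = b) := by
  lift a to NNReal using ha
  lift b to NNReal using hb
  norm_cast
  constructor
  · rw [← NNReal.coe_le_coe]
    push_cast
    nlinarith [sq_nonneg ((a:ℝ) - b)]
  · intro h
    rw [← NNReal.coe_inj] at h ⊢
    push_cast at h
    have : ((a:ℝ) - b) ^ 2 = 0 := by nlinarith
    nlinarith [pow_eq_zero_iff (two_ne_zero) |>.1 this]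

lemma nqnu_pos (N : ℕ) : ∀ᵐ p ∂(nqnu N), 0 < p.1 := by
  have : ∀ᵐ t ∂(volume.restrict (Ioi (0:ℝ))), 0 < t := ae_restrict_mem measurableSet_Ioi
  exact Measure.quasiMeasurePreserving_fst.ae this

lemma nqI_ineq {N : ℕ} (hN : 3 ≤ N) (α β : Measure (Euc N)) [IsProbabilityMeasure α]
    [IsProbabilityMeasure β] : 2 * nqI N α β ≤ nqI N α α + nqI N β β := by
  have hw : Measurable (fun p : ℝ × Euc N => nqw N p.1) := (nqw_meas N).comp measurable_fst
  have hA := nqG_meas N α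
  have hB := nqG_meas N β
  rw [nqI_rep hN, nqI_rep hN, nqI_rep hN, ← lintegral_add_left (by fun_prop), ← lintegral_const_mul _ (by fun_prop)]
  apply lintegral_mono_ae
  filter_upwards [nqnu_pos N] with p hp
  have := (nq_amgm (ne_top_of_le_ne_top one_ne_top (nqG_le α hp))
    (ne_top_of_le_ne_top one_ne_top (nqG_le β hp))).1
  rw [← mul_add, mul_left_comm]
  gcongr

lemma nqI_eq {N : ℕ} (hN : 3 ≤ N) (α β : Measure (Euc N)) [IsProbabilityMeasure α]
    [IsProbabilityMeasure β] (hfin : 2 * nqI N α β ≠ ⊤)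
    (h : nqI N α α + nqI N β β ≤ 2 * nqI N α β) :
    ∃ t : ℝ, 0 < t ∧ ∀ᵐ z : Euc N, nqG N α (t, z) = nqG N β (t, z) := by
  have hw : Measurable (fun p : ℝ × Euc N => nqw N p.1) := (nqw_meas N).comp measurable_fst
  have hA := nqG_meas N α
  have hB := nqG_meas N β
  rw [nqI_rep hN, ← lintegral_const_mul _ (by fun_prop)] at hfin
  rw [nqI_rep hN, nqI_rep hN, nqI_rep hN, ← lintegral_add_left (by fun_prop),
    ← lintegral_const_mul _ (by fun_prop)] at h
  have key := ae_eq_of_ae_le_of_lintegral_le ?_ hfin (by fun_prop) h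
  · have h2 : ∀ᵐ p ∂(nqnu N), nqG N α p = nqG N β p := by
      filter_upwards [nqnu_pos N, key] with p hp hk
      refine (nq_amgm (ne_top_of_le_ne_top one_ne_top (nqG_le α hp))
        (ne_top_of_le_ne_top one_ne_top (nqG_le β hp))).2 ?_
      rw [← mul_add, mul_left_comm] at hk
      exact (ENNReal.mul_right_inj (nqw_pos hN hp).1 (nqw_pos hN hp).2).1 hk
    have h3 := Measure.ae_ae_of_ae_prod h2
    have h4 : ∀ᵐ t ∂(volume.restrict (Ioi (0:ℝ))), 0 < t := ae_restrict_mem measurableSet_Ioi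
    have : NeZero (volume.restrict (Ioi (0:ℝ))) := ⟨by simp⟩
    obtain ⟨t, ht⟩ := (h4.and h3).exists
    exact ⟨t, ht⟩
  · filter_upwards [nqnu_pos N] with p hp
    have := (nq_amgm (ne_top_of_le_ne_top one_ne_top (nqG_le α hp))
      (ne_top_of_le_ne_top one_ne_top (nqG_le β hp))).1
    rw [← mul_add, mul_left_comm]
    gcongr

noncomputable def nqgam (N : ℕ) (t : ℝ) : Measure (Euc N) :=
  volume.withDensity (fun z => ENNReal.ofReal (rexp (-(2 * t) * ‖z‖ ^ 2)))

lemma nqgam_fin {N : ℕ} {t : ℝ} (ht : 0 < t) : IsFiniteMeasure (nqgam N t) := by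
  unfold nqgam
  refine isFiniteMeasure_withDensity_ofReal ?_
  exact (nq_gauss_int (N := N) (b := 2 * t) (by linarith)).1.2

lemma nqgam_conv {N : ℕ} {t : ℝ} (ht : 0 < t) (α : Measure (Euc N)) [IsProbabilityMeasure α] :
    Measure.conv α (nqgam N t) = volume.withDensity (fun z => nqG N α (t, z)) := by
  have := nqgam_fin (N := N) ht
  have hA := nqG_meas N α
  refine Measure.ext_of_lintegral _ fun f hf => ?_
  rw [Measure.lintegral_conv hf, lintegral_withDensity_eq_lintegral_mul _ (by fun_prop) hf]
  have h1 : ∀ x : Euc N, ∫⁻ y, f (x + y) ∂(nqgam N t) = ∫⁻ z, nqg N t x z * f z := by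
    intro x
    unfold nqgam
    rw [lintegral_withDensity_eq_lintegral_mul _ (by fun_prop) (by fun_prop)]
    rw [← lintegral_add_left_eq_self (fun z => nqg N t x z * f z) x]
    refine lintegral_congr fun y => ?_
    simp [nqg]
  simp_rw [h1]
  rw [lintegral_lintegral_swap]
  · refine lintegral_congr fun z => ?_
    rw [lintegral_mul_const _ (by unfold nqg; fun_prop)]
    rfl
  · apply Measurable.aemeasurable
    unfold Function.uncurry nqg
    fun_prop

lemma nqgam_charFun {N : ℕ} {t : ℝ} (ht : 0 < t) (s : Euc N) : charFun (nqgam N t) s ≠ 0 := by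
  have hb : 0 < ((2 * t : ℝ) : ℂ).re := by simpa using ht
  have h := GaussianFourier.integral_cexp_neg_mul_sq_norm_add (V := Euc N) hb Complex.I s
  have : charFun (nqgam N t) s =
    ∫ v : Euc N, Complex.exp (-((2 * t : ℝ) : ℂ) * ‖v‖ ^ 2 + Complex.I * (inner ℝ s v : ℝ)) := by
    rw [charFun_apply, nqgam, integral_withDensity_eq_integral_toReal_smul (by fun_prop)
      (Eventually.of_forall fun _ => ENNReal.ofReal_lt_top)]
    refine integral_congr_ae (Eventually.of_forall fun v => ?_)
    simp only
    rw [ENNReal.toReal_ofReal (Real.exp_pos _).le, Complex.real_smul, Complex.ofReal_exp, ← Complex.exp_add,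
      real_inner_comm]
    congr 1
    push_cast
    ring
  rw [this]
  erw [h]
  refine mul_ne_zero ?_ (Complex.exp_ne_zero _)
  rw [Complex.cpow_ne_zero_iff]
  left
  have : (π:ℂ) ≠ 0 := by exact_mod_cast Real.pi_ne_zero
  have : ((2 * t : ℝ) : ℂ) ≠ 0 := by exact_mod_cast (by linarith : 2 * t ≠ 0)
  exact div_ne_zero ‹_› ‹_›

lemma nqI_unique {N : ℕ} (hN : 3 ≤ N) (α β : Measure (Euc N)) [IsProbabilityMeasure α]
    [IsProbabilityMeasure β] (hfin : 2 * nqI N α β ≠ ⊤)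
    (h : nqI N α α + nqI N β β ≤ 2 * nqI N α β) : α = β := by
  obtain ⟨t, ht, hae⟩ := nqI_eq hN α β hfin h
  have := nqgam_fin (N := N) ht
  have h1 : Measure.conv α (nqgam N t) = Measure.conv β (nqgam N t) := by
    rw [nqgam_conv ht, nqgam_conv ht]
    exact withDensity_congr_ae hae
  refine Measure.ext_of_charFun (funext fun s => ?_)
  have h2 := congrArg (fun m => charFun m s) h1
  simp only [charFun_conv] at h2
  exact mul_right_cancel₀ (nqgam_charFun ht s) h2


noncomputable def nqEta (N : ℕ) (a : Euc N) : Measure (Euc N) :=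
  (volume : Measure (Euc N)).withDensity
    ((Metric.ball a 1).indicator (fun _ => (volume (Metric.ball (0 : Euc N) 1))⁻¹))

lemma nqB_pos (N : ℕ) : volume (Metric.ball (0 : Euc N) 1) ≠ 0 :=
  (Metric.measure_ball_pos volume _ one_pos).ne'

lemma nqB_fin (N : ℕ) : volume (Metric.ball (0 : Euc N) 1) ≠ ⊤ := measure_ball_lt_top.ne

lemma nqEta_eq (N : ℕ) (a : Euc N) : nqEta N a =
    (volume (Metric.ball (0 : Euc N) 1))⁻¹ • volume.restrict (Metric.ball a 1) := by
  rw [nqEta, withDensity_indicator measurableSet_ball, withDensity_const]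

lemma nqEta_lintegral (N : ℕ) (a : Euc N) (f : Euc N → ℝ≥0∞) : ∫⁻ x, f x ∂(nqEta N a) =
    (volume (Metric.ball (0 : Euc N) 1))⁻¹ * ∫⁻ y in Metric.ball (0 : Euc N) 1, f (y + a) := by
  rw [nqEta_eq, lintegral_smul_measure, smul_eq_mul]
  congr 1
  rw [← lintegral_indicator measurableSet_ball, ← lintegral_indicator measurableSet_ball,
    ← lintegral_add_right_eq_self _ a]
  refine lintegral_congr fun y => ?_
  simp [Set.indicator, Metric.mem_ball, dist_eq_norm]

instance nqEta_prob (N : ℕ) (a : Euc N) : IsProbabilityMeasure (nqEta N a) := by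
  constructor
  rw [← lintegral_one, nqEta_lintegral]
  simp [ENNReal.inv_mul_cancel (nqB_pos N) (nqB_fin N)]

lemma nqEta_ae (N : ℕ) (a : Euc N) : ∀ᵐ x ∂(nqEta N a), x ∈ Metric.ball a 1 := by
  rw [nqEta_eq]
  exact Measure.ae_smul_measure (ae_restrict_mem measurableSet_ball) _

lemma nqEta_ae_ne {N : ℕ} (hN : 3 ≤ N) (a b : Euc N) : ∀ᵐ x ∂(nqEta N a), x ≠ b := by
  have : Nonempty (Fin N) := ⟨⟨0, by omega⟩⟩
  rw [nqEta_eq]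
  refine Measure.ae_smul_measure (ae_restrict_of_ae ?_) _
  exact Measure.ae_ne volume b

lemma nqEta_prob2 (N : ℕ) (a : Euc N) : IsProb2 N (nqEta N a) := by
  refine ⟨inferInstance, ?_⟩
  calc ∫⁻ x : Euc N, ENNReal.ofReal (‖x‖ ^ 2) ∂(nqEta N a)
      ≤ ∫⁻ x : Euc N, ENNReal.ofReal ((‖a‖ + 1) ^ 2) ∂(nqEta N a) := by
        refine lintegral_mono_ae ?_
        filter_upwards [nqEta_ae N a] with x hx
        have h1 : ‖x - a‖ < 1 := by simpa [dist_eq_norm] using hx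
        have h2 : ‖x‖ ≤ ‖a‖ + 1 := by
          have := norm_add_le (x - a) a
          rw [sub_add_cancel] at this
          linarith
        gcongr
    _ < ⊤ := by simp

lemma nqEta_pot {N : ℕ} (hN : 3 ≤ N) {x a : Euc N} (hx : x ≠ a) :
    ∫⁻ y, nqK N (x - y) ∂(nqEta N a) = ENNReal.ofReal (nqV N ‖x - a‖) := by
  rw [nqEta_lintegral]
  have h := nq_ball_potential hN (x := x - a) (sub_ne_zero.2 hx)
  have h2 : ∀ y : Euc N, x - (y + a) = x - a - y := fun y => by abel
  simp_rw [h2]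
  rw [h, ENNReal.ofReal_mul measureReal_nonneg, measureReal_def,
    ENNReal.ofReal_toReal (nqB_fin N), ← mul_assoc,
    ENNReal.inv_mul_cancel (nqB_pos N) (nqB_fin N), one_mul]

lemma nqI_eta (N : ℕ) (a : Euc N) : nqI N (nqEta N a) (nqEta N a) =
    nqI N (nqEta N 0) (nqEta N 0) := by
  unfold nqI
  simp_rw [nqEta_lintegral]
  simp

lemma nqV_lower {N : ℕ} (hN : 3 ≤ N) {s : ℝ} (hs : 0 ≤ s) :
    0 ≤ nqV N s ∧ (N:ℝ)/((N:ℝ)-2) ≤ 2 * nqV N s + s^2 := by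
  have hN0 : (3:ℝ) ≤ N := by exact_mod_cast hN
  have hN2 : 0 < (N:ℝ) - 2 := by linarith
  have hc : (N:ℝ)/(2*((N:ℝ)-2)) = 1/2 + 1/((N:ℝ)-2) := by field_simp; ring
  have hc2 : (N:ℝ)/((N:ℝ)-2) = 1 + 2/((N:ℝ)-2) := by field_simp; ring
  unfold nqV
  split_ifs with h
  · have h1 : s^2 ≤ 1 := by nlinarith
    have : 0 < 1/((N:ℝ)-2) := by positivity
    constructor
    · rw [hc]; linarith
    · rw [hc, hc2]; apply le_of_eq; ring
  · push Not at h
    have hs0 : 0 < s := by linarith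
    refine ⟨by positivity, ?_⟩
    -- u = s², (u)^{(2-N)/2} ≥ 1 + (2-N)/2 (u-1)
    have hb : 1 + ((2:ℝ) - N)/2 * (s^2 - 1) ≤ s ^ ((2:ℝ)-N) := by
      have h1 := Real.log_le_sub_one_of_pos (show 0 < s^2 by positivity)
      rw [Real.log_pow] at h1
      push_cast at h1
      rw [Real.rpow_def_of_pos hs0]
      have h2 := Real.add_one_le_exp (Real.log s * ((2:ℝ) - N))
      nlinarith
    rw [hc2]
    have : (1 + ((2:ℝ) - N)/2 * (s^2 - 1))/((N:ℝ)-2) ≤ s ^ ((2:ℝ)-N)/((N:ℝ)-2) := by gcongr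
    have e : (1 + ((2:ℝ) - N)/2 * (s^2 - 1))/((N:ℝ)-2) = 1/((N:ℝ)-2) - (s^2-1)/2 := by
      field_simp; ring
    rw [e] at this
    have e2 : 2/((N:ℝ)-2) = 2 * (1/((N:ℝ)-2)) := by ring
    rw [e2]; linarith

lemma nqV_inside {N : ℕ} (hN : 3 ≤ N) {s : ℝ} (h : s < 1) :
    2 * nqV N s + s^2 = (N:ℝ)/((N:ℝ)-2) := by
  have hN0 : (3:ℝ) ≤ N := by exact_mod_cast hN
  have hN2 : 0 < (N:ℝ) - 2 := by linarith
  simp only [nqV, h, if_true]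
  field_simp; ring

noncomputable def nqS (N : ℕ) (μ : Measure (Euc N)) (b : Euc N) : ℝ≥0∞ :=
  ∫⁻ x, ENNReal.ofReal (‖x - b‖^2) ∂μ

lemma nqS_meas (N : ℕ) (b : Euc N) :
    Measurable fun x : Euc N => ENNReal.ofReal (‖x - b‖^2) := by fun_prop

lemma nq_pot_sum {N : ℕ} (μ : Measure (Euc N)) (b : Euc N) :
    2 * nqI N μ (nqEta N b) + nqS N μ b =
      ∫⁻ x, (2 * ∫⁻ y, nqK N (x - y) ∂(nqEta N b)) + ENNReal.ofReal (‖x - b‖^2) ∂μ := by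
  have hm : Measurable fun x : Euc N => ∫⁻ y, nqK N (x - y) ∂(nqEta N b) :=
    ((nqK_meas N).comp (measurable_fst.sub measurable_snd)).lintegral_prod_right'
  rw [lintegral_add_right _ (nqS_meas N b), lintegral_const_mul _ hm]
  rfl

lemma nq_pot_val {N : ℕ} (hN : 3 ≤ N) {x b : Euc N} (hx : x ≠ b) :
    (2 * ∫⁻ y, nqK N (x - y) ∂(nqEta N b)) + ENNReal.ofReal (‖x - b‖^2) =
      ENNReal.ofReal (2 * nqV N ‖x - b‖ + ‖x - b‖^2) := by
  have h0 := (nqV_lower hN (norm_nonneg (x - b))).1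
  rw [nqEta_pot hN hx, ENNReal.ofReal_add (by positivity) (by positivity),
    ENNReal.ofReal_mul (by norm_num)]
  simp

lemma nq_lower {N : ℕ} (hN : 3 ≤ N) (μ : Measure (Euc N)) [IsProbabilityMeasure μ] (b : Euc N)
    (hb : ∀ᵐ x ∂μ, x ≠ b) :
    ENNReal.ofReal ((N:ℝ)/((N:ℝ)-2)) ≤ 2 * nqI N μ (nqEta N b) + nqS N μ b := by
  rw [nq_pot_sum]
  calc ENNReal.ofReal ((N:ℝ)/((N:ℝ)-2)) = ∫⁻ _x, ENNReal.ofReal ((N:ℝ)/((N:ℝ)-2)) ∂μ := by simp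
    _ ≤ _ := by
      refine lintegral_mono_ae ?_
      filter_upwards [hb] with x hx
      rw [nq_pot_val hN hx]
      exact ENNReal.ofReal_le_ofReal (nqV_lower hN (norm_nonneg _)).2

lemma nq_upper {N : ℕ} (hN : 3 ≤ N) (b : Euc N) :
    2 * nqI N (nqEta N b) (nqEta N b) + nqS N (nqEta N b) b =
      ENNReal.ofReal ((N:ℝ)/((N:ℝ)-2)) := by
  rw [nq_pot_sum]
  calc _ = ∫⁻ _x, ENNReal.ofReal ((N:ℝ)/((N:ℝ)-2)) ∂(nqEta N b) := by
        refine lintegral_congr_ae ?_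
        filter_upwards [nqEta_ae_ne hN b b, nqEta_ae N b] with x hx hx1
        have h1 : ‖x - b‖ < 1 := by simpa [dist_eq_norm] using hx1
        rw [nq_pot_val hN hx, nqV_inside hN h1]
    _ = _ := by simp

lemma nq_noatom {N : ℕ} (hN : 3 ≤ N) (μ : Measure (Euc N)) (b : Euc N)
    (hfin : nqI N μ μ ≠ ⊤) : ∀ᵐ x ∂μ, x ≠ b := by
  have hN0 : (3:ℝ) ≤ N := by exact_mod_cast hN
  have hK0 : nqK N 0 = ⊤ := by
    unfold nqK
    rw [norm_zero, ENNReal.ofReal_zero, ENNReal.zero_rpow_of_neg (by linarith)]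
    exact ENNReal.top_div_of_ne_top ENNReal.ofReal_ne_top
  by_contra hcon
  have hpos : μ {b} ≠ 0 := by
    intro h
    apply hcon
    rw [ae_iff]
    simpa using h
  apply hfin
  rw [eq_top_iff]
  calc (⊤:ℝ≥0∞) = ∫⁻ x in {b}, ∫⁻ y in {b}, nqK N (x - y) ∂μ ∂μ := by
        simp only [Measure.restrict_singleton, lintegral_smul_measure, lintegral_dirac, sub_self,
          hK0, smul_eq_mul]
        rw [ENNReal.mul_top hpos, ENNReal.mul_top hpos]
    _ ≤ ∫⁻ x, ∫⁻ y, nqK N (x - y) ∂μ ∂μ := by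
        refine (setLIntegral_le_lintegral _ _).trans ?_
        exact lintegral_mono fun x => setLIntegral_le_lintegral _ _

lemma nq_split (N : ℕ) (μ : Measure (Euc N)) [IsProbabilityMeasure μ] :
    2 * interE N (newtQuadW N) μ =
      (∫⁻ x, ∫⁻ y, ENNReal.ofReal (‖x - y‖^2/2) ∂μ ∂μ) + nqI N μ μ := by
  unfold interE nqI
  rw [← mul_assoc, one_div, ENNReal.mul_inv_cancel (by norm_num) (by norm_num), one_mul]
  have hm : Measurable fun x : Euc N => ∫⁻ y, nqK N (x - y) ∂μ :=
    ((nqK_meas N).comp (measurable_fst.sub measurable_snd)).lintegral_prod_right'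
  rw [← lintegral_add_right _ hm]
  refine lintegral_congr fun x => ?_
  rw [← lintegral_add_left (by fun_prop)]
  rfl

lemma nq_quad (N : ℕ) (μ : Measure (Euc N)) (hμ : IsProb2 N μ) (b : Euc N) :
    nqS N μ b = ENNReal.ofReal (∫ x, ‖x - b‖^2 ∂μ) ∧
    (∫⁻ x, ∫⁻ y, ENNReal.ofReal (‖x - y‖^2/2) ∂μ ∂μ) =
      ENNReal.ofReal ((∫ x, ‖x - b‖^2 ∂μ) - ‖(∫ x, x ∂μ) - b‖^2) := by
  have := hμ.1
  have hL : MemLp (fun x : Euc N => x) 2 μ := by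
    rw [memLp_two_iff_integrable_sq_norm (by fun_prop)]
    refine ⟨by fun_prop, ?_⟩
    rw [hasFiniteIntegral_iff_ofReal (Eventually.of_forall fun x => by positivity)]
    exact hμ.2
  have hi2 : ∀ b : Euc N, Integrable (fun x : Euc N => ‖x - b‖^2) μ := fun b =>
    (hL.sub (memLp_const b)).integrable_norm_pow (by norm_num)
  have hi1 : Integrable (fun x : Euc N => x) μ := hL.integrable (by norm_num)
  have hib : Integrable (fun x : Euc N => x - b) μ := hi1.sub (integrable_const b)
  have hmb : ∫ x, (x - b) ∂μ = (∫ x, x ∂μ) - b := by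
    rw [integral_sub hi1 (integrable_const b)]; simp
  have hin : ∀ x : Euc N, Integrable (fun y : Euc N => inner ℝ (x - b) (y - b)) μ := fun x =>
    hib.const_inner _
  have key : ∀ x : Euc N, ∫⁻ y, ENNReal.ofReal (‖x - y‖^2/2) ∂μ =
      ENNReal.ofReal ((‖x - b‖^2 - 2 * inner ℝ (x - b) ((∫ x, x ∂μ) - b) +
        ∫ y, ‖y - b‖^2 ∂μ)/2) := by
    intro x
    have hpt : ∀ y : Euc N, ‖x - y‖^2/2 =
        (‖x - b‖^2 - 2 * inner ℝ (x - b) (y - b) + ‖y - b‖^2)/2 := by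
      intro y
      rw [← norm_sub_sq_real]; simp
    have hint : Integrable (fun y : Euc N =>
        (‖x - b‖^2 - 2 * inner ℝ (x - b) (y - b) + ‖y - b‖^2)/2) μ :=
      ((((integrable_const _).sub ((hin x).const_mul 2))).add (hi2 b)).div_const 2
    rw [← ofReal_integral_eq_lintegral_ofReal (by simp_rw [hpt]; exact hint)
      (Eventually.of_forall fun y => by positivity)]
    congr 1
    simp_rw [hpt]
    have hsub : Integrable (fun y : Euc N => ‖x - b‖^2 - 2 * inner ℝ (x - b) (y - b)) μ :=
      (integrable_const _).sub ((hin x).const_mul 2)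
    rw [integral_div, integral_add hsub (hi2 b),
      integral_sub (integrable_const _) ((hin x).const_mul 2), integral_const_mul,
      integral_inner hib, hmb]
    simp
  have hin2 : Integrable (fun x : Euc N => inner ℝ (x - b) ((∫ x, x ∂μ) - b)) μ :=
    hib.inner_const _
  have hint : Integrable (fun x : Euc N =>
      (‖x - b‖^2 - 2 * inner ℝ (x - b) ((∫ x, x ∂μ) - b) + ∫ y, ‖y - b‖^2 ∂μ)/2) μ :=
    (((hi2 b).sub (hin2.const_mul 2)).add (integrable_const _)).div_const 2
  have hsub : Integrable (fun x : Euc N =>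
      ‖x - b‖^2 - 2 * inner ℝ (x - b) ((∫ x, x ∂μ) - b)) μ := (hi2 b).sub (hin2.const_mul 2)
  constructor
  · rw [nqS, ← ofReal_integral_eq_lintegral_ofReal (hi2 b)
      (Eventually.of_forall fun y => by positivity)]
  · simp_rw [key]
    rw [← ofReal_integral_eq_lintegral_ofReal hint]
    · congr 1
      rw [integral_div, integral_add hsub (integrable_const _),
        integral_sub (hi2 b) (hin2.const_mul 2), integral_const_mul]
      have : ∫ x, inner ℝ (x - b) ((∫ x, x ∂μ) - b) ∂μ = ‖(∫ x, x ∂μ) - b‖^2 := by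
        simp_rw [real_inner_comm ((∫ x, x ∂μ) - b)]
        rw [integral_inner hib, hmb, real_inner_self_eq_norm_sq]
      rw [this]
      simp
      ring
    · refine Eventually.of_forall fun x => ?_
      have h1 : ‖(∫ x, x ∂μ) - b‖^2 ≤ ∫ y, ‖y - b‖^2 ∂μ := by
        have h0 : 0 ≤ ∫ y, ‖(y - b) - ((∫ x, x ∂μ) - b)‖^2 ∂μ :=
          integral_nonneg fun y => by positivity
        have e : ∀ y : Euc N, ‖(y - b) - ((∫ x, x ∂μ) - b)‖^2 =
          ‖y - b‖^2 - 2 * inner ℝ (y - b) ((∫ x, x ∂μ) - b) + ‖(∫ x, x ∂μ) - b‖^2 := fun y =>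
            norm_sub_sq_real _ _
        simp_rw [e] at h0
        rw [integral_add hsub (integrable_const _),
          integral_sub (hi2 b) (hin2.const_mul 2), integral_const_mul] at h0
        have : ∫ x, inner ℝ (x - b) ((∫ x, x ∂μ) - b) ∂μ = ‖(∫ x, x ∂μ) - b‖^2 := by
          simp_rw [real_inner_comm ((∫ x, x ∂μ) - b)]
          rw [integral_inner hib, hmb, real_inner_self_eq_norm_sq]
        rw [this] at h0
        simp at h0
        linarith
      have h2 := norm_sub_sq_real (x - b) ((∫ x, x ∂μ) - b)
      have h3 := sq_nonneg ‖(x - b) - ((∫ x, x ∂μ) - b)‖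
      simp only [Pi.zero_apply]
      linarith

lemma nqE_lower {N : ℕ} (μ : Measure (Euc N)) (hμ : IsProb2 N μ) :
    2 * interE N (newtQuadW N) μ = nqS N μ (∫ x, x ∂μ) + nqI N μ μ := by
  have := hμ.1
  obtain ⟨h1, h2⟩ := nq_quad N μ hμ (∫ x, x ∂μ)
  rw [nq_split, h2, h1]; simp

lemma nqE_upper {N : ℕ} (μ : Measure (Euc N)) (hμ : IsProb2 N μ) (b : Euc N) :
    2 * interE N (newtQuadW N) μ ≤ nqS N μ b + nqI N μ μ := by
  have := hμ.1
  obtain ⟨h1, h2⟩ := nq_quad N μ hμ b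
  rw [nq_split, h2, h1]
  gcongr
  have := sq_nonneg ‖(∫ x, x ∂μ) - b‖
  linarith

lemma nqE_eta {N : ℕ} (hN : 3 ≤ N) (a : Euc N) :
    2 * interE N (newtQuadW N) (nqEta N a) + nqI N (nqEta N 0) (nqEta N 0) ≤
      ENNReal.ofReal ((N:ℝ)/((N:ℝ)-2)) := by
  rw [← nq_upper hN a, ← nqI_eta N a]
  refine (add_le_add_left (nqE_upper _ (nqEta_prob2 N a) a) _).trans (le_of_eq ?_)
  ring

lemma nqI_eta_fin {N : ℕ} (hN : 3 ≤ N) (a : Euc N) : nqI N (nqEta N a) (nqEta N a) ≠ ⊤ := by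
  have h := nqE_eta hN a
  rw [nqI_eta]
  exact ne_top_of_le_ne_top ENNReal.ofReal_ne_top (le_add_self.trans h)

lemma nqE_min {N : ℕ} (hN : 3 ≤ N) (a : Euc N) (μ : Measure (Euc N)) (hμ : IsProb2 N μ) :
    interE N (newtQuadW N) (nqEta N a) ≤ interE N (newtQuadW N) μ := by
  have := hμ.1
  by_cases hfin : nqI N μ μ = ⊤
  · have h := nqE_lower μ hμ
    rw [hfin, add_top, ENNReal.mul_eq_top] at h
    rcases h with h | h
    · rw [h.2]; exact le_top
    · exact absurd h.1 (by norm_num)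
  · set m := ∫ x, x ∂μ with hm
    have h1 := nq_lower hN μ m (nq_noatom hN μ m hfin)
    have h2 := nqI_ineq hN μ (nqEta N m)
    have h3 := nqE_lower μ hμ
    have h4 := nqE_eta hN a
    rw [nqI_eta N m] at h2
    have h5 : 2 * interE N (newtQuadW N) (nqEta N a) + nqI N (nqEta N 0) (nqEta N 0) ≤
        2 * interE N (newtQuadW N) μ + nqI N (nqEta N 0) (nqEta N 0) := by
      refine h4.trans (h1.trans ((add_le_add_left h2 _).trans (le_of_eq ?_)))
      rw [h3]; ring
    have h6 := (ENNReal.add_le_add_iff_right (nqI_eta_fin hN 0)).1 h5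
    exact (ENNReal.mul_le_mul_iff_right (by norm_num) (by norm_num)).1 h6

lemma nqE_unique {N : ℕ} (hN : 3 ≤ N) (μ : Measure (Euc N)) (hμ : IsProb2 N μ)
    (h : interE N (newtQuadW N) μ ≤ interE N (newtQuadW N) (nqEta N (∫ x, x ∂μ))) :
    μ = nqEta N (∫ x, x ∂μ) := by
  have := hμ.1
  set m := ∫ x, x ∂μ with hm
  have h4 := nqE_eta hN m
  have h3 := nqE_lower μ hμ
  rw [← hm] at h3
  have h5 : nqS N μ m + nqI N μ μ + nqI N (nqEta N m) (nqEta N m) ≤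
      ENNReal.ofReal ((N:ℝ)/((N:ℝ)-2)) := by
    rw [← h3, nqI_eta N m]
    refine le_trans ?_ h4
    gcongr
  have hall := ne_top_of_le_ne_top ENNReal.ofReal_ne_top h5
  have hS : nqS N μ m ≠ ⊤ := by
    intro h; simp [h] at hall
  have hI : nqI N μ μ ≠ ⊤ := by
    intro h; simp [h] at hall
  have h1 := nq_lower hN μ m (nq_noatom hN μ m hI)
  have h6 : (nqI N μ μ + nqI N (nqEta N m) (nqEta N m)) + nqS N μ m ≤
      2 * nqI N μ (nqEta N m) + nqS N μ m := by
    refine le_trans (le_of_eq ?_) (h5.trans h1)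
    ring
  have h7 := (ENNReal.add_le_add_iff_right hS).1 h6
  refine nqI_unique hN μ (nqEta N m) ?_ h7
  exact ne_top_of_le_ne_top (ENNReal.add_ne_top.2 ⟨hI, nqI_eta_fin hN m⟩) (nqI_ineq hN _ _)


/-- **Characterization of global minimizers for Newtonian repulsion with quadratic
attraction.**  For `W(x) = |x|²/2 − |x|^{2−N}/(2−N)` on `ℝ^N`, `N ≥ 3`, there is a
radius `R > 0` such that the global minimizers of the interaction energy over
`𝒫₂(ℝ^N)` are exactly the uniform probability measures on balls of radius `R`. -/
theorem global_minimizer_is_ball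
    (N : ℕ) (hN : 3 ≤ N) :
    ∃ R : ℝ, 0 < R ∧
      ∀ μ : Measure (Euc N), IsProb2 N μ →
        ((∀ ν : Measure (Euc N), IsProb2 N ν →
            interE N (newtQuadW N) μ ≤ interE N (newtQuadW N) ν) ↔
          ∃ x₀ : Euc N,
            μ = (volume : Measure (Euc N)).withDensity
              ((Metric.ball x₀ R).indicator
                (fun _ => (volume (Metric.ball (0 : Euc N) R))⁻¹))) := by
  refine ⟨1, one_pos, fun μ hμ => ⟨fun h => ?_, ?_⟩⟩
  · exact ⟨_, nqE_unique hN μ hμ (h _ (nqEta_prob2 N _))⟩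
  · rintro ⟨a, rfl⟩ ν hν
    exact nqE_min hN a ν hν
end

section
/- Getoor's identity: Let N ≥ 1 and 0 < σ < 2. There exists a constant K = K(N,σ) > 0 such that for every y ∈ ℝ^N with |y| < 1, the principal-value integral lim_{ε→0⁺} ∫_{{z : |z−y| > ε}} [ (1 − |y|²)^{σ/2} − (1 − |z|²)₊^{σ/2} ] / |y − z|^{N+σ} dz exists and equals K; i.e. the fractional Laplacian of order σ of the function x ↦ (1 − |x|²)₊^{σ/2} is constant on the open unit ball. -/
open MeasureTheory Real Set Filter

noncomputable section

/-- The integrand of Getoor's identity: the (unnormalized) fractional Laplacian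
integrand of the function `x ↦ (1 − |x|²)₊^{σ/2}` at the point `y`. -/
noncomputable def getoorIntegrand (N : ℕ) (σ : ℝ) (y z : Euc N) : ℝ :=
  ((1 - ‖y‖ ^ 2) ^ (σ / 2) - (max (1 - ‖z‖ ^ 2) 0) ^ (σ / 2)) / ‖y - z‖ ^ ((N : ℝ) + σ)

/-- positive part power integral -/
lemma pp_intble (s : ℝ) (hs : 0 < s) (u v : ℝ) :
    IntervalIntegrable (fun x : ℝ => (max x 0) ^ (s - 1)) volume u v := by
  by_cases h1 : s = 1
  · subst h1; simp
  have hne : s - 1 ≠ 0 := sub_ne_zero.mpr h1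
  have h := (intervalIntegral.intervalIntegrable_rpow' (a := u) (b := v) (r := s - 1) (by linarith))
  have h2 : IntervalIntegrable (indicator (Ioi 0) (fun x : ℝ => x ^ (s - 1))) volume u v :=
    ⟨h.1.indicator measurableSet_Ioi, h.2.indicator measurableSet_Ioi⟩
  convert h2 using 2 with x
  by_cases hx : 0 < x
  · simp [indicator, hx, max_eq_left hx.le]
  · simp [indicator, hx, max_eq_right (not_lt.mp hx), Real.zero_rpow hne]

lemma pp_int0 (s : ℝ) (hs : 0 < s) (hs1 : s < 1) (v : ℝ) :
    ∫ x in (0:ℝ)..v, (max x 0) ^ (s - 1) = (max v 0) ^ s / s := by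
  rcases le_total 0 v with hv | hv
  · rw [intervalIntegral.integral_congr (g := fun x => x ^ (s-1)), integral_rpow (by left; linarith)]
    · simp [max_eq_left hv, Real.zero_rpow hs.ne']
    · intro x hx
      rw [uIcc_of_le hv] at hx
      simp [max_eq_left hx.1]
  · rw [intervalIntegral.integral_congr (g := fun x => 0)]
    · simp [max_eq_right hv, Real.zero_rpow hs.ne']
    · intro x hx
      rw [uIcc_of_ge hv] at hx
      simp [max_eq_right hx.2, Real.zero_rpow (sub_ne_zero.mpr hs1.ne)]

lemma pp_int (s : ℝ) (hs : 0 < s) (hs1 : s < 1) (u v : ℝ) :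
    ∫ x in u..v, (max x 0) ^ (s - 1) = (max v 0) ^ s / s - (max u 0) ^ s / s := by
  rw [← pp_int0 s hs hs1, ← pp_int0 s hs hs1,
    intervalIntegral.integral_interval_sub_left (pp_intble s hs _ _) (pp_intble s hs _ _)]

/-- the basic quadratic, positive part -/
def rr (a b k : ℝ) : ℝ := max (a * k ^ 2 - 2 * b * k - 1) 0

lemma rr_nonneg (a b k : ℝ) : 0 ≤ rr a b k := le_max_right _ _

lemma rr_beta_int (a s k p q : ℝ) (hs : 0 < s) (hs1 : s < 1) (hk : 0 < k) :
    ∫ β in p..q, rr a β k ^ (s - 1) = (rr a p k ^ s - rr a q k ^ s) / k / (2 * s) := by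
  have h := intervalIntegral.integral_comp_sub_mul (a := p) (b := q)
    (fun x : ℝ => (max x 0) ^ (s - 1)) (c := 2 * k) (by positivity) (a * k ^ 2 - 1)
  rw [pp_int s hs hs1] at h
  unfold rr
  have e : ∀ β : ℝ, a * k ^ 2 - 2 * β * k - 1 = a * k ^ 2 - 1 - 2 * k * β := by intro β; ring
  simp only [e]
  rw [h, smul_eq_mul]
  field_simp

lemma rr_beta_intble (a s k p q : ℝ) (hs : 0 < s) (hk : 0 < k) :
    IntervalIntegrable (fun β => rr a β k ^ (s - 1)) volume p q := by
  have h := ((pp_intble s hs (a * k ^ 2 - 1 - 2 * k * p) (a * k ^ 2 - 1 - 2 * k * q)).comp_sub_left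
    (a * k ^ 2 - 1)).comp_mul_left (c := 2 * k)
  have hk2 : 2 * k ≠ 0 := by positivity
  convert h using 1
  · ext β; unfold rr; congr 2; ring
  · rw [sub_sub_cancel, mul_div_cancel_left₀ _ hk2]
  · rw [sub_sub_cancel, mul_div_cancel_left₀ _ hk2]

lemma rr_meas (a : ℝ) : Measurable (fun x : ℝ × ℝ => rr a x.1 x.2) := by
  unfold rr; fun_prop

lemma rr_div_intble (a b s L : ℝ) (ha : 0 < a) (hs : 0 < s) :
    IntegrableOn (fun k => rr a b k ^ s / k) (Ioc 0 L) := by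
  have hm : Measurable (fun k => rr a b k ^ s / k) := by unfold rr; fun_prop
  refine Measure.integrableOn_of_bounded (M := (a * L ^ 2 + 2 * |b| * L + 1) ^ s * (1 + a + 2 * |b|))
    (by simp) hm.aestronglyMeasurable ?_
  refine (ae_restrict_iff' measurableSet_Ioc).mpr (ae_of_all _ ?_)
  rintro k ⟨hk0, hkL⟩
  have hb : -|b| ≤ b := neg_abs_le b
  have hb2 : 0 ≤ |b| := abs_nonneg b
  have hL : 0 < L := hk0.trans_le hkL
  rw [Real.norm_of_nonneg (div_nonneg (Real.rpow_nonneg (rr_nonneg _ _ _) _) hk0.le)]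
  by_cases h : k ≤ 1 / (1 + a + 2 * |b|)
  · have hr : rr a b k = 0 := by
      unfold rr
      apply max_eq_right
      rw [le_div_iff₀ (by positivity)] at h
      have hk1 : k ≤ 1 := by nlinarith
      nlinarith [mul_nonneg ha.le hk0.le]
    rw [hr, Real.zero_rpow hs.ne', zero_div]; positivity
  · push Not at h
    rw [div_eq_mul_inv]
    have h3 : k⁻¹ ≤ 1 + a + 2 * |b| := by
      rw [div_lt_iff₀ (by positivity)] at h
      rw [inv_le_iff_one_le_mul₀ hk0]; linarith
    have h4 : rr a b k ≤ a * L ^ 2 + 2 * |b| * L + 1 := by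
      unfold rr
      apply max_le _ (by positivity)
      have : a * k ^ 2 ≤ a * L ^ 2 := by gcongr
      have : |b| * k ≤ |b| * L := by gcongr
      nlinarith
    have := Real.rpow_le_rpow (rr_nonneg _ _ _) h4 hs.le
    exact mul_le_mul this h3 (by positivity) (by positivity)

lemma rr_fubini_intble (a s L p q : ℝ) (ha : 0 < a) (hs : 0 < s) (hs1 : s < 1) (hpq : p ≤ q) :
    Integrable (Function.uncurry (fun β k => rr a β k ^ (s - 1)))
      ((volume.restrict (Ioc p q)).prod (volume.restrict (Ioc 0 L))) := by
  rw [integrable_prod_iff']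
  · constructor
    · refine (ae_restrict_iff' measurableSet_Ioc).mpr (ae_of_all _ ?_)
      rintro k ⟨hk0, hkL⟩
      exact (rr_beta_intble a s k p q hs hk0).1
    · have h : IntegrableOn (fun k => (rr a p k ^ s / k - rr a q k ^ s / k) / (2 * s)) (Ioc 0 L) :=
        ((rr_div_intble a p s L ha hs).sub (rr_div_intble a q s L ha hs)).div_const _
      refine h.congr ?_
      refine (ae_restrict_iff' measurableSet_Ioc).mpr (ae_of_all _ ?_)
      rintro k ⟨hk0, hkL⟩
      have : ∀ β, ‖Function.uncurry (fun β k => rr a β k ^ (s - 1)) (β, k)‖ = rr a β k ^ (s-1) := by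
        intro β
        exact Real.norm_of_nonneg (Real.rpow_nonneg (rr_nonneg _ _ _) _)
      simp only [this]
      rw [← intervalIntegral.integral_of_le hpq, rr_beta_int a s k p q hs hs1 hk0]; ring
  · exact ((rr_meas a).pow_const (s-1)).aestronglyMeasurable

lemma rr_fubini (a s L p q : ℝ) (ha : 0 < a) (hs : 0 < s) (hs1 : s < 1) (hpq : p ≤ q)
    (hL : 0 ≤ L) :
    ∫ k in (0:ℝ)..L, (rr a p k ^ s / k - rr a q k ^ s / k) =
      (2 * s) * ∫ β in p..q, ∫ k in (0:ℝ)..L, rr a β k ^ (s - 1) := by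
  have h := integral_integral_swap (rr_fubini_intble a s L p q ha hs hs1 hpq)
  simp only [intervalIntegral.integral_of_le hpq, intervalIntegral.integral_of_le hL]
  rw [h, ← integral_const_mul]
  refine setIntegral_congr_fun measurableSet_Ioc ?_
  rintro k ⟨hk0, hkL⟩
  simp only
  rw [← intervalIntegral.integral_of_le hpq, rr_beta_int a s k p q hs hs1 hk0]
  field_simp

lemma rr_fubini_outer (a s L p q : ℝ) (ha : 0 < a) (hs : 0 < s) (hs1 : s < 1) (hpq : p ≤ q)
    (hL : 0 ≤ L) :
    IntervalIntegrable (fun β => ∫ k in (0:ℝ)..L, rr a β k ^ (s - 1)) volume p q := by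
  have h := (rr_fubini_intble a s L p q ha hs hs1 hpq).integral_prod_left
  simp only [intervalIntegral.integral_of_le hL]
  rw [intervalIntegrable_iff_integrableOn_Ioc_of_le hpq]
  exact h

/-- The even function -/
lemma qq_intble (a ρ s u v : ℝ) (ha : 0 < a) (hρ : 0 < ρ) (hs : 0 < s) (hs1 : s < 1) :
    IntervalIntegrable (fun x : ℝ => (max (a * x ^ 2 - ρ) 0) ^ (s - 1)) volume u v := by
  set x0 := √(ρ / a) with hx0
  have hx0p : 0 < x0 := Real.sqrt_pos.mpr (by positivity)
  have hx0s : a * x0 ^ 2 = ρ := by rw [hx0, Real.sq_sqrt (by positivity)]; field_simp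
  have h1 := (pp_intble s hs (u - x0) (v - x0)).comp_sub_right x0
  have h2 := (pp_intble s hs (-x0 - u) (-x0 - v)).comp_sub_left (-x0)
  simp only [sub_add_cancel, sub_sub_cancel] at h1 h2
  have h3 := (h1.add h2).const_mul ((a * x0) ^ (s - 1))
  refine h3.mono_fun (by
    have : Measurable (fun x : ℝ => (max (a * x ^ 2 - ρ) 0) ^ (s - 1)) := by fun_prop
    exact this.aestronglyMeasurable) (ae_of_all _ ?_)
  intro x
  have hne : s - 1 ≠ 0 := by linarith
  simp only [Pi.add_apply]
  rw [Real.norm_of_nonneg (by positivity), Real.norm_of_nonneg (by positivity)]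
  have P1 : 0 ≤ (max (x - x0) 0) ^ (s - 1) := by positivity
  have P2 : 0 ≤ (max (-x0 - x) 0) ^ (s - 1) := by positivity
  have P3 : 0 ≤ (a * x0) ^ (s - 1) := by positivity
  by_cases hx : a * x ^ 2 - ρ ≤ 0
  · rw [max_eq_right hx, Real.zero_rpow hne]; positivity
  · push Not at hx
    rw [max_eq_left hx.le]
    have hxx : x0 ^ 2 < x ^ 2 := by
      by_contra hcon
      push Not at hcon
      nlinarith
    rcases le_total 0 x with h | h
    · have : x0 < x := by nlinarith
      rw [mul_add]
      have : (a * x ^ 2 - ρ) ^ (s - 1) ≤ (a * x0) ^ (s - 1) * (max (x - x0) 0) ^ (s - 1) := by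
        rw [max_eq_left (by linarith), ← Real.mul_rpow (by positivity) (by linarith)]
        apply Real.rpow_le_rpow_of_nonpos
        · have : 0 < x - x0 := by linarith
          positivity
        · rw [← hx0s]
          have := mul_pos ha (mul_pos (sub_pos.mpr this) (hx0p.trans this))
          nlinarith
        · linarith
      nlinarith [mul_nonneg P3 P2]
    · have : x0 < -x := by nlinarith
      rw [mul_add]
      have : (a * x ^ 2 - ρ) ^ (s - 1) ≤ (a * x0) ^ (s - 1) * (max (-x0 - x) 0) ^ (s - 1) := by
        rw [max_eq_left (by linarith), ← Real.mul_rpow (by positivity) (by linarith)]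
        apply Real.rpow_le_rpow_of_nonpos
        · have : 0 < -x0 - x := by linarith
          positivity
        · rw [← hx0s]
          have := mul_pos ha (mul_pos (sub_pos.mpr this) (hx0p.trans this))
          nlinarith
        · linarith
      nlinarith [mul_nonneg P3 P1]

lemma rr_shift_bound (a s L β : ℝ) (ha : 0 < a) (hs : 0 < s) (hs1 : s < 1)
    (hβ : 0 ≤ β) (hβ1 : β ≤ 1) (hL0 : 0 < L) (hL : 0 < a * L ^ 2 - 2 * L - 1) :
    |(∫ k in (0:ℝ)..L, rr a β k ^ (s - 1)) - ∫ k in (0:ℝ)..L, rr a (-β) k ^ (s - 1)| ≤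
      (a * L ^ 2 - 2 * L - 1) ^ (s - 1) * (2 / a) := by
  set c := β / a with hc
  set ρ := 1 + β ^ 2 / a with hρ
  have hρp : 0 < ρ := by positivity
  have hcβ : a * c = β := by rw [hc]; field_simp
  have hρ2 : ρ = 1 + a * c ^ 2 := by rw [hρ, hc]; field_simp
  have hc0 : 0 ≤ c := by positivity
  set q := (fun x : ℝ => (max (a * x ^ 2 - ρ) 0) ^ (s - 1)) with hq
  have e1 : ∀ k, rr a β k ^ (s - 1) = q (k - c) := by
    intro k; simp only [hq, rr]; congr 2; rw [hρ2, ← hcβ]; ring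
  have e2 : ∀ k, rr a (-β) k ^ (s - 1) = q (k - (-c)) := by
    intro k; simp only [hq, rr]; congr 2; rw [hρ2, ← hcβ]; ring
  simp only [e1, e2]
  rw [intervalIntegral.integral_comp_sub_right q c, intervalIntegral.integral_comp_sub_right q (-c)]
  have hI : ∀ u v, IntervalIntegrable q volume u v := fun u v => qq_intble a ρ s u v ha hρp hs hs1
  rw [intervalIntegral.integral_interval_sub_interval_comm (hI _ _) (hI _ _) (hI _ _)]
  have z : ∫ x in (0 - c)..(0 - -c), q x = 0 := by
    rw [intervalIntegral.integral_congr (g := fun _ => 0)]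
    · simp
    · intro x hx
      rw [uIcc_of_le (by linarith)] at hx
      have : x ^ 2 ≤ c ^ 2 := by nlinarith [hx.1, hx.2]
      simp only [hq]
      rw [max_eq_right (by rw [hρ2]; nlinarith), Real.zero_rpow (by linarith)]
  rw [z, zero_sub, abs_neg]
  have := intervalIntegral.norm_integral_le_of_norm_le_const (a := L - c) (b := L - -c) (f := q)
    (C := (a * L ^ 2 - 2 * L - 1) ^ (s - 1)) ?_
  · rw [Real.norm_eq_abs] at this
    refine this.trans ?_
    gcongr
    rw [show L - -c - (L - c) = 2 * c by ring, abs_of_nonneg (by positivity), hc,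
      le_div_iff₀ ha]
    field_simp; linarith
  · intro x hx
    rw [uIoc_of_le (by linarith)] at hx
    have hLc : c ≤ L := by
      have : a * c ≤ a * L := by rw [hcβ]; nlinarith
      exact le_of_mul_le_mul_left this ha
    have h1 : (L - c) ^ 2 ≤ x ^ 2 := by nlinarith [hx.1]
    have h2 : a * L ^ 2 - 2 * L - 1 ≤ a * x ^ 2 - ρ := by
      rw [hρ2]
      have : a * (L - c) ^ 2 ≤ a * x ^ 2 := by gcongr
      nlinarith [mul_nonneg hL0.le (sub_nonneg.mpr hβ1)]
    simp only [hq]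
    rw [max_eq_left (by linarith), Real.norm_of_nonneg (Real.rpow_nonneg (by linarith) _)]
    exact Real.rpow_le_rpow_of_nonpos hL h2 (by linarith)

lemma rr_sym_bound_nonneg (a s L b : ℝ) (ha : 0 < a) (hs : 0 < s) (hs1 : s < 1)
    (hb : 0 ≤ b) (hb1 : b ≤ 1) (hL0 : 0 < L) (hL : 0 < a * L ^ 2 - 2 * L - 1) :
    |∫ k in (0:ℝ)..L, (2 * (rr a 0 k ^ s / k) - rr a b k ^ s / k - rr a (-b) k ^ s / k)| ≤
      4 * s / a * (a * L ^ 2 - 2 * L - 1) ^ (s - 1) := by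
  have hI : ∀ b, IntervalIntegrable (fun k => rr a b k ^ s / k) volume 0 L := fun b => by
    rw [intervalIntegrable_iff_integrableOn_Ioc_of_le hL0.le]
    exact rr_div_intble a b s L ha hs
  have e : ∫ k in (0:ℝ)..L, (2 * (rr a 0 k ^ s / k) - rr a b k ^ s / k - rr a (-b) k ^ s / k) =
      (∫ k in (0:ℝ)..L, (rr a 0 k ^ s / k - rr a b k ^ s / k)) -
      ∫ k in (0:ℝ)..L, (rr a (-b) k ^ s / k - rr a 0 k ^ s / k) := by
    rw [← intervalIntegral.integral_sub ((hI _).sub (hI _)) ((hI _).sub (hI _))]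
    congr 1; ext k; ring
  rw [e, rr_fubini a s L 0 b ha hs hs1 hb hL0.le,
    rr_fubini a s L (-b) 0 ha hs hs1 (by linarith) hL0.le]
  have hn := intervalIntegral.integral_comp_neg (a := 0) (b := b)
    (fun β => ∫ k in (0:ℝ)..L, rr a β k ^ (s - 1))
  rw [neg_zero] at hn
  rw [← hn, ← mul_sub]
  have O1 := rr_fubini_outer a s L 0 b ha hs hs1 hb hL0.le
  have O2 := (rr_fubini_outer a s L (-b) 0 ha hs hs1 (by linarith) hL0.le).comp_sub_left 0
  simp only [zero_sub, neg_neg, neg_zero, sub_zero] at O2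
  rw [← intervalIntegral.integral_sub O1 O2.symm, abs_mul, abs_of_pos (by positivity)]
  have := intervalIntegral.norm_integral_le_of_norm_le_const (a := 0) (b := b)
    (f := fun β => (∫ k in (0:ℝ)..L, rr a β k ^ (s - 1)) - ∫ k in (0:ℝ)..L, rr a (-β) k ^ (s - 1))
    (C := (a * L ^ 2 - 2 * L - 1) ^ (s - 1) * (2 / a)) ?_
  · rw [Real.norm_eq_abs, sub_zero, abs_of_nonneg hb] at this
    have P : 0 ≤ (a * L ^ 2 - 2 * L - 1) ^ (s - 1) * (2 / a) := by positivity
    calc _ ≤ 2 * s * ((a * L ^ 2 - 2 * L - 1) ^ (s - 1) * (2 / a) * b) := by gcongr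
      _ ≤ 2 * s * ((a * L ^ 2 - 2 * L - 1) ^ (s - 1) * (2 / a) * 1) := by gcongr
      _ = _ := by ring
  · intro β hβ
    rw [uIoc_of_le hb] at hβ
    exact rr_shift_bound a s L β ha hs hs1 hβ.1.le (hβ.2.trans hb1) hL0 hL

lemma rr_sym_bound (a s L b : ℝ) (ha : 0 < a) (hs : 0 < s) (hs1 : s < 1)
    (hb1 : |b| ≤ 1) (hL0 : 0 < L) (hL : 0 < a * L ^ 2 - 2 * L - 1) :
    |∫ k in (0:ℝ)..L, (2 * (rr a 0 k ^ s / k) - rr a b k ^ s / k - rr a (-b) k ^ s / k)| ≤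
      4 * s / a * (a * L ^ 2 - 2 * L - 1) ^ (s - 1) := by
  rcases le_total 0 b with hb | hb
  · exact rr_sym_bound_nonneg a s L b ha hs hs1 hb (by rwa [abs_of_nonneg hb] at hb1) hL0 hL
  · have := rr_sym_bound_nonneg a s L (-b) ha hs hs1 (by linarith)
      (by rwa [abs_of_nonpos hb] at hb1) hL0 hL
    convert this using 4 with k
    rw [neg_neg]; ring

/-- the limiting 1D integrand -/
def kap (s k : ℝ) : ℝ := (k ^ (2 * s) - rr 1 0 k ^ s) / k

lemma kap_nonneg (s k : ℝ) (hs : 0 < s) (hk : 0 < k) : 0 ≤ kap s k := by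
  unfold kap
  apply div_nonneg _ hk.le
  rw [sub_nonneg, Real.rpow_mul hk.le]
  apply Real.rpow_le_rpow (rr_nonneg _ _ _) _ hs.le
  unfold rr
  apply max_le <;> norm_num
  positivity

lemma kap_meas (s : ℝ) : Measurable (kap s) := by
  unfold kap rr; fun_prop

lemma kap_intble (s : ℝ) (hs : 0 < s) (hs1 : s < 1) : IntegrableOn (kap s) (Ioi 0) := by
  rw [← Ioc_union_Ioi_eq_Ioi (zero_le_one' ℝ)]
  apply IntegrableOn.union
  · have h : IntegrableOn (fun k : ℝ => k ^ (2 * s - 1)) (Ioc 0 1) := by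
      rw [← intervalIntegrable_iff_integrableOn_Ioc_of_le zero_le_one]
      exact intervalIntegral.intervalIntegrable_rpow' (by linarith)
    refine h.congr_fun ?_ measurableSet_Ioc
    rintro k ⟨hk0, hk1⟩
    have : rr 1 0 k = 0 := by unfold rr; apply max_eq_right; nlinarith
    simp only [kap, this]
    rw [Real.zero_rpow hs.ne', sub_zero, Real.rpow_sub_one hk0.ne']
  · have h := integrableOn_Ioi_rpow_of_lt (a := 2 * s - 3) (c := 1) (by linarith) one_pos
    refine h.mono' (kap_meas s).aestronglyMeasurable ?_
    refine (ae_restrict_iff' measurableSet_Ioi).mpr (ae_of_all _ ?_)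
    intro k hk
    have hk1 : 1 < k := hk
    have hk0 : 0 < k := by linarith
    rw [Real.norm_of_nonneg (kap_nonneg s k hs hk0)]
    unfold kap
    have hr : rr 1 0 k = k ^ 2 * (1 - 1 / k ^ 2) := by
      unfold rr; rw [max_eq_left (by nlinarith)]; field_simp; ring
    have hk2 : 1 / k ^ 2 < 1 := by
      rw [div_lt_one (by positivity)]; nlinarith
    have h1 : 1 - 1 / k ^ 2 ≤ (1 - 1 / k ^ 2) ^ s := by
      have hp : 0 < 1 / k ^ 2 := by positivity
      calc 1 - 1 / k ^ 2 = (1 - 1 / k ^ 2) ^ (1:ℝ) := by simp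
        _ ≤ _ := Real.rpow_le_rpow_of_exponent_ge (by linarith) (by linarith) hs1.le
    rw [hr, Real.mul_rpow (by positivity) (by linarith)]
    have h2 : (k ^ 2) ^ s = k ^ (2 * s) := by
      rw [Real.rpow_mul hk0.le]; norm_num
    have h3 : k ^ (2 * s - 3) = k ^ (2 * s) / k ^ 3 := by
      rw [Real.rpow_sub hk0]; norm_num
    rw [h2, h3, div_le_div_iff₀ hk0 (by positivity)]
    have hP : 0 < k ^ (2 * s) := by positivity
    have h4 : k ^ (2 * s) - k ^ (2 * s) * (1 - 1 / k ^ 2) ^ s ≤ k ^ (2 * s) / k ^ 2 := by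
      have := mul_le_mul_of_nonneg_left h1 hP.le
      have e : k ^ (2 * s) * (1 - 1 / k ^ 2) = k ^ (2 * s) - k ^ (2 * s) / k ^ 2 := by ring
      linarith
    calc _ ≤ k ^ (2 * s) / k ^ 2 * k ^ 3 := by gcongr
      _ = _ := by field_simp

def kappa (s : ℝ) : ℝ := ∫ k in Ioi 0, kap s k

lemma kappa_pos (s : ℝ) (hs : 0 < s) (hs1 : s < 1) : 0 < kappa s := by
  unfold kappa
  rw [setIntegral_pos_iff_support_of_nonneg_ae _ (kap_intble s hs hs1)]
  · refine lt_of_lt_of_le ?_ (measure_mono (s := Ioo (0:ℝ) 1) ?_)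
    · simp
    · rintro k ⟨hk0, hk1⟩
      refine ⟨?_, hk0⟩
      have : rr 1 0 k = 0 := by unfold rr; apply max_eq_right; nlinarith
      simp only [Function.mem_support, kap, this]
      rw [Real.zero_rpow hs.ne', sub_zero]
      have : 0 < k ^ (2 * s) := by positivity
      positivity
  · refine (ae_restrict_iff' measurableSet_Ioi).mpr (ae_of_all _ ?_)
    intro k hk
    exact kap_nonneg s k hs hk

lemma kap_scale (a s L : ℝ) (ha : 0 < a) (hL : 0 ≤ L) :
    ∫ k in (0:ℝ)..L, (a ^ s * k ^ (2 * s) / k - rr a 0 k ^ s / k) = 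
      ∫ k in (0:ℝ)..(√a * L), kap s k := by
  have h := intervalIntegral.integral_comp_mul_left (a := 0) (b := L) (kap s) (c := √a)
    (Real.sqrt_pos.mpr ha).ne'
  have h0 : √a ≠ 0 := (Real.sqrt_pos.mpr ha).ne'
  rw [mul_zero, smul_eq_mul] at h
  rw [eq_comm, ← mul_left_cancel_iff_of_pos (inv_pos.mpr (Real.sqrt_pos.mpr ha)), ← h,
    ← intervalIntegral.integral_const_mul]
  apply intervalIntegral.integral_congr
  intro k hk
  rw [uIcc_of_le hL] at hk
  have hk0 := hk.1
  simp only [kap]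
  have e1 : rr 1 0 (√a * k) = rr a 0 k := by
    unfold rr; rw [mul_pow, Real.sq_sqrt ha.le]; ring_nf
  have e2 : (√a * k) ^ (2 * s) = a ^ s * k ^ (2 * s) := by
    rw [Real.mul_rpow (by positivity) hk0, Real.rpow_mul (by positivity)]
    congr 2
    rw [Real.rpow_two, Real.sq_sqrt ha.le]
  rw [e1, e2]
  rcases hk0.eq_or_lt with rfl | hk0
  · simp
  · field_simp

/-- the symmetrized 1D truncated integral -/
def SS (a s L b : ℝ) : ℝ :=
  ∫ k in (0:ℝ)..L, (2 * (a ^ s * k ^ (2 * s)) - rr a b k ^ s - rr a (-b) k ^ s) / k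

lemma SS_bound (a s L b : ℝ) (ha : 0 < a) (hs : 0 < s) (hs1 : s < 1)
    (hb1 : |b| ≤ 1) (hL0 : 0 < L) (hL : 0 < a * L ^ 2 - 2 * L - 1) :
    |SS a s L b - 2 * ∫ k in (0:ℝ)..(√a * L), kap s k| ≤
      4 * s / a * (a * L ^ 2 - 2 * L - 1) ^ (s - 1) := by
  have hI : ∀ b, IntervalIntegrable (fun k => rr a b k ^ s / k) volume 0 L := fun b => by
    rw [intervalIntegrable_iff_integrableOn_Ioc_of_le hL0.le]
    exact rr_div_intble a b s L ha hs
  have hP : IntervalIntegrable (fun k => a ^ s * k ^ (2 * s) / k) volume 0 L := by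
    have h := (intervalIntegral.intervalIntegrable_rpow' (a := 0) (b := L) (r := 2 * s - 1)
      (by linarith)).const_mul (a ^ s)
    refine h.congr ?_
    intro k hk
    rw [uIoc_of_le hL0.le] at hk
    simp only
    rw [Real.rpow_sub_one hk.1.ne']; ring
  rw [← kap_scale a s L ha hL0.le, ← intervalIntegral.integral_const_mul]
  unfold SS
  have e0 : ∀ k, (2 * (a ^ s * k ^ (2 * s)) - rr a b k ^ s - rr a (-b) k ^ s) / k =
    2 * (a ^ s * k ^ (2 * s) / k) - rr a b k ^ s / k - rr a (-b) k ^ s / k := by intro k; ring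
  simp only [e0]
  rw [← intervalIntegral.integral_sub (((hP.const_mul 2).sub (hI _)).sub (hI _))
    ((hP.sub (hI _)).const_mul 2)]
  convert rr_sym_bound a s L b ha hs hs1 hb1 hL0 hL using 4 with k
  ring

open Metric in
lemma polar_integral (N : ℕ) (hN1 : 1 ≤ N) (f : Euc N → ℝ) (hf : Integrable f) :
    Integrable (fun θ : sphere (0 : Euc N) 1 => ∫ r in Ioi (0:ℝ), r ^ (N - 1) * f (r • (θ : Euc N)))
      (volume : Measure (Euc N)).toSphere ∧
    ∫ x, f x = ∫ θ : sphere (0 : Euc N) 1, (∫ r in Ioi (0:ℝ), r ^ (N - 1) * f (r • (θ : Euc N)))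
      ∂(volume : Measure (Euc N)).toSphere := by
  have hN : Module.finrank ℝ (Euc N) = N := by simp
  have : Nonempty (Fin N) := ⟨⟨0, hN1⟩⟩
  have MP := (volume : Measure (Euc N)).measurePreserving_homeomorphUnitSphereProd
  set g : sphere (0 : Euc N) 1 × Ioi (0:ℝ) → ℝ := fun p => f (p.2.1 • p.1.1) with hg
  have hgc : ∀ x : ({(0 : Euc N)}ᶜ : Set (Euc N)), g (homeomorphUnitSphereProd (Euc N) x) = f x.1 := by
    intro x
    have hx : ‖x.1‖ ≠ 0 := norm_ne_zero_iff.mpr x.2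
    simp [hg, smul_smul, hx]
  have i1 : ∫ x, f x = ∫ x : ({(0 : Euc N)}ᶜ : Set (Euc N)), f x.1 ∂(volume.comap Subtype.val) := by
    rw [integral_subtype_comap (measurableSet_singleton _).compl f, restrict_compl_singleton]
  have i2 := MP.integral_comp (Homeomorph.measurableEmbedding _) g
  have hint : Integrable g ((volume : Measure (Euc N)).toSphere.prod
      (Measure.volumeIoiPow (Module.finrank ℝ (Euc N) - 1))) := by
    rw [← MP.integrable_comp_emb (Homeomorph.measurableEmbedding _)]
    have : g ∘ (homeomorphUnitSphereProd (Euc N)) = fun x => f x.1 := funext hgc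
    rw [this]
    have h2 : IntegrableOn f {(0 : Euc N)}ᶜ := hf.integrableOn
    rwa [integrableOn_iff_comap_subtypeVal (measurableSet_singleton _).compl] at h2
  simp only [hgc] at i2
  have inner_eq : ∀ θ : sphere (0 : Euc N) 1,
      ∫ r, g (θ, r) ∂(Measure.volumeIoiPow (Module.finrank ℝ (Euc N) - 1)) =
      ∫ r in Ioi (0:ℝ), r ^ (N - 1) * f (r • (θ : Euc N)) := by
    intro θ
    simp only [Measure.volumeIoiPow, ENNReal.ofReal, hg]
    rw [integral_withDensity_eq_integral_smul (by fun_prop),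
      integral_subtype_comap measurableSet_Ioi
        fun a ↦ Real.toNNReal (a ^ (Module.finrank ℝ (Euc N) - 1)) • f (a • θ.1)]
    refine setIntegral_congr_fun measurableSet_Ioi ?_
    intro r hr
    have hr' : (0:ℝ) < r := hr
    simp only [hN, NNReal.smul_def, smul_eq_mul]
    rw [Real.coe_toNNReal _ (by positivity)]
  constructor
  · have := hint.integral_prod_left
    simpa only [inner_eq] using this
  · rw [i1, i2, integral_prod _ hint]
    simp only [inner_eq]

/-- truncated symmetrized integrand -/
def PP (N : ℕ) (σ : ℝ) (y : Euc N) (ε : ℝ) (h : Euc N) : ℝ :=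
  indicator {h : Euc N | ε < ‖h‖} (fun h => getoorIntegrand N σ y (y + h)) h

lemma gI_bound (N : ℕ) (σ : ℝ) (hσ : 0 < σ) (y : Euc N) (hy : ‖y‖ < 1) (h : Euc N) :
    |getoorIntegrand N σ y (y + h)| ≤ 1 * ‖h‖ ^ (-((N : ℝ) + σ)) := by
  unfold getoorIntegrand
  have e : ‖y - (y + h)‖ = ‖h‖ := by simp
  rw [e, abs_div, abs_of_nonneg (a := ‖h‖ ^ _) (by positivity), Real.rpow_neg (norm_nonneg _),
    div_eq_mul_inv]
  gcongr
  have hy2 : ‖y‖ ^ 2 < 1 := by nlinarith [norm_nonneg y]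
  have b1 : (1 - ‖y‖ ^ 2) ^ (σ / 2) ≤ 1 :=
    Real.rpow_le_one (by linarith) (by nlinarith [norm_nonneg y]) (by linarith)
  have b2 : (max (1 - ‖y + h‖ ^ 2) 0) ^ (σ / 2) ≤ 1 :=
    Real.rpow_le_one (by positivity) (max_le (by nlinarith [norm_nonneg (y+h)]) (by norm_num))
      (by linarith)
  have b3 : 0 ≤ (1 - ‖y‖ ^ 2) ^ (σ / 2) := Real.rpow_nonneg (by linarith) _
  have b4 : 0 ≤ (max (1 - ‖y + h‖ ^ 2) 0) ^ (σ / 2) := by positivity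
  rw [abs_le]; constructor <;> linarith

lemma PP_intble (N : ℕ) (hN : 1 ≤ N) (σ : ℝ) (hσ : 0 < σ) (y : Euc N) (hy : ‖y‖ < 1) (ε : ℝ)
    (hε : 0 < ε) : Integrable (PP N σ y ε) := by
  have : Nonempty (Fin N) := ⟨⟨0, hN⟩⟩
  have hd : Integrable (fun h : Euc N =>
      (fun r : ℝ => indicator (Ioi ε) (fun r => r ^ (-((N : ℝ) + σ))) r) ‖h‖) := by
    rw [integrable_fun_norm_addHaar]
    have h := integrableOn_Ioi_rpow_of_lt (a := -1 - σ) (c := ε) (by linarith) hε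
    rw [← integrable_indicator_iff measurableSet_Ioi] at h
    refine h.integrableOn.congr_fun ?_ measurableSet_Ioi
    intro r hr
    have hr0 : (0:ℝ) < r := hr
    by_cases hr1 : ε < r
    · simp only [indicator, mem_Ioi, hr1, if_true, smul_eq_mul, finrank_euclideanSpace,
        Fintype.card_fin]
      rw [← Real.rpow_natCast, ← Real.rpow_add hr0, Nat.cast_sub hN]
      congr 1; push_cast; ring
    · simp [indicator, hr1]
  refine hd.mono' ?_ (ae_of_all _ ?_)
  · have : Measurable (PP N σ y ε) := by
      unfold PP
      apply Measurable.indicator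
      · unfold getoorIntegrand; fun_prop
      · exact measurableSet_lt measurable_const measurable_norm
    exact this.aestronglyMeasurable
  · intro h
    unfold PP
    by_cases hr1 : ε < ‖h‖
    · simp only [indicator, mem_Ioi, mem_ofPred_eq, hr1, if_true]
      simpa using gI_bound N σ hσ y hy h
    · simp [indicator, hr1]

lemma PP_eq (N : ℕ) (σ : ℝ) (y : Euc N) (ε : ℝ) :
    ∫ z in {z : Euc N | ε < dist z y}, getoorIntegrand N σ y z = ∫ h, PP N σ y ε h := by
  have hm : MeasurableSet {z : Euc N | ε < dist z y} :=
    measurableSet_lt measurable_const (by fun_prop)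
  rw [← integral_indicator hm, ← integral_add_left_eq_self _ y]
  congr 1; ext h
  simp [PP, indicator]

lemma PP_sym (N : ℕ) (hN : 1 ≤ N) (σ : ℝ) (hσ : 0 < σ) (y : Euc N) (hy : ‖y‖ < 1) (ε : ℝ)
    (hε : 0 < ε) : ∫ h, PP N σ y ε h = (1 / 2) * ∫ h, (PP N σ y ε h + PP N σ y ε (-h)) := by
  have hI := PP_intble N hN σ hσ y hy ε hε
  rw [integral_add hI hI.comp_neg, integral_neg_eq_self]
  ring

lemma gI_radial (N : ℕ) (hN : 1 ≤ N) (σ : ℝ) (y : Euc N) (k : ℝ)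
    (hk : 0 < k) (θ : Euc N) (hθ : ‖θ‖ = 1) :
    k ^ (-2 : ℝ) * ((k⁻¹) ^ (N - 1) * getoorIntegrand N σ y (y + k⁻¹ • θ)) =
      ((1 - ‖y‖ ^ 2) ^ (σ / 2) * k ^ σ - rr (1 - ‖y‖ ^ 2) (inner ℝ y θ) k ^ (σ / 2)) / k := by
  unfold getoorIntegrand
  have e1 : ‖y - (y + k⁻¹ • θ)‖ = k⁻¹ := by
    rw [sub_add_cancel_left, norm_neg, norm_smul, hθ, mul_one, Real.norm_of_nonneg (by positivity)]
  have e2 : max (1 - ‖y + k⁻¹ • θ‖ ^ 2) 0 = (k⁻¹) ^ 2 * rr (1 - ‖y‖ ^ 2) (inner ℝ y θ) k := by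
    unfold rr
    rw [mul_max_of_nonneg _ _ (by positivity), mul_zero, norm_add_sq_real, inner_smul_right,
      norm_smul, hθ, Real.norm_of_nonneg (by positivity : 0 ≤ k⁻¹)]
    congr 1
    field_simp
    ring
  have e3 : ((k⁻¹) ^ 2) ^ (σ / 2) = (k ^ σ)⁻¹ := by
    rw [← Real.rpow_natCast, ← Real.rpow_mul (by positivity), Real.inv_rpow hk.le]
    congr 2; push_cast; ring
  have e4 : (k⁻¹) ^ ((N:ℝ) + σ) = (k⁻¹) ^ (N - 1) * k⁻¹ * (k ^ σ)⁻¹ := by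
    rw [Real.rpow_add (by positivity), Real.inv_rpow hk.le σ, Real.rpow_natCast, ← pow_succ,
      Nat.sub_add_cancel hN]
  have e5 : k ^ (-2 : ℝ) = (k ^ 2)⁻¹ := by
    rw [Real.rpow_neg hk.le, Real.rpow_two]
  rw [e1, e2, Real.mul_rpow (by positivity) (rr_nonneg _ _ _), e3, e4, e5]
  have hkσ : 0 < k ^ σ := by positivity
  field_simp

lemma PP_radial (N : ℕ) (hN : 1 ≤ N) (σ : ℝ) (y : Euc N) (ε : ℝ)
    (hε : 0 < ε) (θ : Euc N) (hθ : ‖θ‖ = 1) :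
    ∫ r in Ioi (0:ℝ), r ^ (N - 1) * (PP N σ y ε (r • θ) + PP N σ y ε (-(r • θ))) =
      SS (1 - ‖y‖ ^ 2) (σ / 2) (1 / ε) (inner ℝ y θ) := by
  rw [← integral_comp_rpow_Ioi _ (neg_ne_zero.mpr one_ne_zero)]
  unfold SS
  rw [intervalIntegral.integral_of_le (by positivity), integral_Ioc_eq_integral_Ioo,
    ← Ioi_inter_Iio, ← setIntegral_indicator measurableSet_Iio]
  refine setIntegral_congr_fun measurableSet_Ioi ?_
  intro k hk
  have hk0 : 0 < k := hk
  have en : ‖k⁻¹ • θ‖ = k⁻¹ := by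
    rw [norm_smul, hθ, mul_one, Real.norm_of_nonneg (by positivity)]
  have h1 := gI_radial N hN σ y k hk0 θ hθ
  have h2 := gI_radial N hN σ y k hk0 (-θ) (by rwa [norm_neg])
  rw [inner_neg_right, smul_neg] at h2
  simp only [Real.rpow_neg_one, PP, indicator, mem_ofPred_eq, norm_neg, en, mem_Iio, smul_eq_mul,
    abs_neg, abs_one, one_mul]
  have hiff : ε < k⁻¹ ↔ k < 1 / ε := by
    rw [lt_inv_comm₀ hε hk0, one_div]
  rw [show (-1 - 1 : ℝ) = -2 by norm_num, show 2 * (σ / 2) = σ by ring]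
  by_cases hc : k < 1 / ε
  · rw [if_pos (hiff.mpr hc), if_pos (hiff.mpr hc), if_pos hc, mul_add, mul_add, h1, h2]
    ring
  · rw [if_neg (mt hiff.mp hc), if_neg (mt hiff.mp hc), if_neg hc]
    simp

lemma est_tendsto (a s : ℝ) (ha : 0 < a) (hs : 0 < s) (hs1 : s < 1) :
    Tendsto (fun L : ℝ => 4 * s / a * (a * L ^ 2 - 2 * L - 1) ^ (s - 1) +
      |2 * (∫ k in (0:ℝ)..(√a * L), kap s k) - 2 * kappa s|) atTop (nhds 0) := by
  have hq : Tendsto (fun L : ℝ => a * L ^ 2 - 2 * L - 1) atTop atTop := by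
    have h1 : Tendsto (fun L : ℝ => L * (a * L - 2) + (-1)) atTop atTop := by
      apply tendsto_atTop_add_const_right
      apply Tendsto.atTop_mul_atTop₀ tendsto_id
      exact tendsto_atTop_add_const_right _ (-2) (tendsto_id.const_mul_atTop ha)
    refine h1.congr ?_
    intro L; ring
  have h1 : Tendsto (fun L : ℝ => 4 * s / a * (a * L ^ 2 - 2 * L - 1) ^ (s - 1)) atTop (nhds 0) := by
    have := ((tendsto_rpow_neg_atTop (y := 1 - s) (by linarith)).comp hq).const_mul (4 * s / a)
    simpa using this
  have h2 : Tendsto (fun L : ℝ => ∫ k in (0:ℝ)..(√a * L), kap s k) atTop (nhds (kappa s)) :=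
    intervalIntegral_tendsto_integral_Ioi 0 (kap_intble s hs hs1)
      (tendsto_id.const_mul_atTop (Real.sqrt_pos.mpr ha))
  have h3 := (((h2.const_mul 2).sub_const (2 * kappa s)).abs)
  rw [sub_self, abs_zero] at h3
  simpa using h1.add h3

open Metric in
lemma main_bound (N : ℕ) (hN : 1 ≤ N) (σ : ℝ) (hσ0 : 0 < σ) (hσ2 : σ < 2) (y : Euc N)
    (hy : ‖y‖ < 1) (ε : ℝ) (hε : 0 < ε)
    (hL : 0 < (1 - ‖y‖ ^ 2) * (1 / ε) ^ 2 - 2 * (1 / ε) - 1) :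
    |(∫ z in {z : Euc N | ε < dist z y}, getoorIntegrand N σ y z) -
      (volume : Measure (Euc N)).toSphere.real univ * kappa (σ / 2)| ≤
    (1 / 2) * ((4 * (σ / 2) / (1 - ‖y‖ ^ 2) * ((1 - ‖y‖ ^ 2) * (1 / ε) ^ 2 - 2 * (1 / ε) - 1) ^ (σ / 2 - 1) +
      |2 * (∫ k in (0:ℝ)..(√(1 - ‖y‖ ^ 2) * (1 / ε)), kap (σ / 2) k) - 2 * kappa (σ / 2)|) *
      (volume : Measure (Euc N)).toSphere.real univ) := by
  have ha0 : 0 < 1 - ‖y‖ ^ 2 := by nlinarith [norm_nonneg y]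
  have hI := PP_intble N hN σ hσ0 y hy ε hε
  obtain ⟨p1, p2⟩ := polar_integral N hN (fun h => PP N σ y ε h + PP N σ y ε (-h)) (hI.add hI.comp_neg)
  have hr : ∀ θ : sphere (0 : Euc N) 1, _ :=
    fun θ => PP_radial N hN σ y ε hε θ.1 (by simpa using θ.2)
  simp only [hr] at p1 p2
  rw [PP_eq, PP_sym N hN σ hσ0 y hy ε hε, p2]
  have e : (volume : Measure (Euc N)).toSphere.real univ * kappa (σ / 2) =
      (1 / 2) * ∫ θ : sphere (0 : Euc N) 1, 2 * kappa (σ / 2) ∂(volume : Measure (Euc N)).toSphere := by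
    rw [integral_const, smul_eq_mul]; ring
  rw [e, ← mul_sub, ← integral_sub p1 (integrable_const _), abs_mul, abs_of_pos (by norm_num)]
  refine mul_le_mul_of_nonneg_left ?_ (by norm_num)
  rw [← Real.norm_eq_abs (∫ _, _ ∂_)]
  refine norm_integral_le_of_norm_le_const (μ := (volume : Measure (Euc N)).toSphere) (ae_of_all _ ?_)
  intro θ
  have hθ : ‖θ.1‖ = 1 := by simpa using θ.2
  have hb : |(inner ℝ y θ.1 : ℝ)| ≤ 1 := by
    have := abs_real_inner_le_norm y θ.1
    rw [hθ, mul_one] at this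
    linarith
  have := SS_bound (1 - ‖y‖ ^ 2) (σ / 2) (1 / ε) (inner ℝ y θ.1) ha0 (by linarith) (by linarith) hb
    (by positivity) hL
  rw [Real.norm_eq_abs]
  refine (abs_sub_le _ (2 * ∫ k in (0:ℝ)..(√(1 - ‖y‖ ^ 2) * (1 / ε)), kap (σ / 2) k) _).trans ?_
  gcongr

/-- **Getoor's identity.**  For `0 < σ < 2` there is a constant `K = K(N,σ) > 0` such
that for every `y` in the open unit ball, the principal-value integral
`P.V. ∫ ((1−|y|²)^{σ/2} − (1−|z|²)₊^{σ/2})/|y−z|^{N+σ} dz` exists and equals `K`;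
i.e. the fractional Laplacian of order `σ` of `x ↦ (1−|x|²)₊^{σ/2}` is constant on
the unit ball. -/
theorem getoor_identity
    (N : ℕ) (hN : 1 ≤ N) (σ : ℝ) (hσ0 : 0 < σ) (hσ2 : σ < 2) :
    ∃ K : ℝ, 0 < K ∧
      ∀ y : Euc N, ‖y‖ < 1 →
        Tendsto (fun ε : ℝ =>
            ∫ z in {z : Euc N | ε < dist z y}, getoorIntegrand N σ y z)
          (nhdsWithin 0 (Ioi 0)) (nhds K) := by
  have : Nonempty (Fin N) := ⟨⟨0, hN⟩⟩
  refine ⟨(volume : Measure (Euc N)).toSphere.real univ * kappa (σ / 2), ?_, ?_⟩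
  · apply mul_pos _ (kappa_pos _ (by linarith) (by linarith))
    rw [measureReal_def, ENNReal.toReal_pos_iff]
    refine ⟨?_, measure_lt_top _ _⟩
    rw [pos_iff_ne_zero, Ne, Measure.measure_univ_eq_zero]
    exact Measure.toSphere_ne_zero _
  · intro y hy
    have ha0 : 0 < 1 - ‖y‖ ^ 2 := by nlinarith [norm_nonneg y]
    have hE : Tendsto (fun ε : ℝ => 1 / ε) (nhdsWithin 0 (Ioi 0)) atTop := by
      simpa using tendsto_inv_nhdsGT_zero (𝕜 := ℝ)
    have hlim := (((est_tendsto (1 - ‖y‖ ^ 2) (σ / 2) ha0 (by linarith) (by linarith)).comp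
      hE).mul_const ((volume : Measure (Euc N)).toSphere.real univ)).const_mul (1 / 2)
    rw [zero_mul, mul_zero] at hlim
    rw [tendsto_iff_norm_sub_tendsto_zero]
    refine squeeze_zero' (Eventually.of_forall fun _ => norm_nonneg _) ?_ hlim
    filter_upwards [self_mem_nhdsWithin, hE.eventually_gt_atTop (3 / (1 - ‖y‖ ^ 2))] with ε hε hL
    rw [div_lt_iff₀ ha0] at hL
    have hε0 : 0 < ε := hε
    have hL1 : 1 < 1 / ε := by
      have : 1 / ε * (1 - ‖y‖ ^ 2) ≤ 1 / ε * 1 := by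
        have : 0 < 1 / ε := by positivity
        gcongr
        nlinarith [norm_nonneg y]
      linarith
    exact main_bound N hN σ hσ0 hσ2 y hy ε hε (by nlinarith)
end
end
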